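/- arXiv:math/0312368 — 6 statements merged into one kernel-verified Lean document; each statement's English description precedes it below -/
import Mathlib

section
/- For every n ≥ 2, the field of G-invariants of k(X)_0 is generated over k by the observables q_r for 1 ≤ r ≤ n(n-1)/2; that is, k(X)_0^G = k(q_1, q_2, …, q_{n(n-1)/2}). -/
noncomputable section

open scoped Classical

abbrev RF (k : Type) [Field k] (n : ℕ) := FractionRing (MvPolynomial (Fin n) k)

def xv (k : Type) [Field k] (n : ℕ) (i : Fin n) : RF k n :=
  algebraMap (MvPolynomial (Fin n) k) (RF k n) (MvPolynomial.X i)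

/-- The set of ratios `x_i / x_j`, `i ≠ j`, generating `k(X)₀`. -/
def ratioSet (k : Type) [Field k] (n : ℕ) : Set (RF k n) :=
  {r | ∃ i j : Fin n, i ≠ j ∧ r = xv k n i / xv k n j}

/-- The observable `q_r = tr(X^r) · tr(X^{-r})`. -/
def qObs (k : Type) [Field k] (n : ℕ) (r : ℤ) : RF k n :=
  (∑ i, xv k n i ^ r) * (∑ i, xv k n i ^ (-r))

/-- The subgroup of automorphisms of `k(x_1,…,x_n)` generated by the
permutations of the variables and by simultaneous inversion of all variables
(the image of `G = S_n × T`). -/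
def Gsub (k : Type) [Field k] (n : ℕ) : Subgroup (RF k n ≃ₐ[k] RF k n) :=
  Subgroup.closure {φ | ∃ σ : Equiv.Perm (Fin n),
    (∀ i, φ (xv k n i) = xv k n (σ i)) ∨ (∀ i, φ (xv k n i) = (xv k n (σ i))⁻¹)}

/-- The invariant field `k(X)₀^G`. -/
def InvF (k : Type) [Field k] (n : ℕ) : IntermediateField k (RF k n) :=
  IntermediateField.adjoin k (ratioSet k n) ⊓ IntermediateField.fixedField (Gsub k n)

lemma xv_ne_zero (k : Type) [Field k] (n : ℕ) (i : Fin n) : xv k n i ≠ 0 := by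
  simp [xv, MvPolynomial.X_ne_zero]

lemma xv_algebraicIndependent (k : Type) [Field k] (n : ℕ) : AlgebraicIndependent k (xv k n) := by
  have h := (MvPolynomial.algebraicIndependent_X (Fin n) k).map'
    (f := IsScalarTower.toAlgHom k (MvPolynomial (Fin n) k) (RF k n))
    (IsFractionRing.injective (MvPolynomial (Fin n) k) (RF k n))
  exact h

lemma RF_algHom_ext {k : Type} [Field k] {n : ℕ} {A : Type*} [Semiring A] [Algebra k A]
    {f g : RF k n →ₐ[k] A} (h : ∀ i, f (xv k n i) = g (xv k n i)) : f = g := by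
  apply IsLocalization.algHom_ext (nonZeroDivisors (MvPolynomial (Fin n) k))
  exact MvPolynomial.algHom_ext h

lemma isAlgebraic_RF {k : Type} [Field k] {n : ℕ} (A : Subalgebra k (RF k n))
    (h : ∀ i, IsAlgebraic A (xv k n i)) : Algebra.IsAlgebraic A (RF k n) := by
  have key (p : MvPolynomial (Fin n) k) : IsAlgebraic A (algebraMap _ (RF k n) p) := by
    induction p using MvPolynomial.induction_on with
    | C a =>
      have : algebraMap (MvPolynomial (Fin n) k) (RF k n) (MvPolynomial.C a) =
        algebraMap A (RF k n) (algebraMap k A a) := by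
        rw [← IsScalarTower.algebraMap_apply, ← MvPolynomial.algebraMap_eq,
          ← IsScalarTower.algebraMap_apply]
      rw [this]
      exact isAlgebraic_algebraMap _
    | add p q hp hq => rw [map_add]; exact hp.add hq
    | mul_X p i hp => rw [map_mul]; exact hp.mul (h i)
  refine ⟨fun z ↦ ?_⟩
  obtain ⟨a, b, -, rfl⟩ := IsFractionRing.div_surjective (A := MvPolynomial (Fin n) k) z
  rw [div_eq_mul_inv]
  exact (key a).mul (key b).inv

lemma algebraicIndependent_xv_inv (k : Type) [Field k] (n : ℕ) :
    AlgebraicIndependent k (fun i ↦ (xv k n i)⁻¹) := by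
  have : Algebra.IsAlgebraic (Algebra.adjoin k (Set.range fun i ↦ (xv k n i)⁻¹)) (RF k n) := by
    refine isAlgebraic_RF _ fun i ↦ ?_
    rw [← IsAlgebraic.inv_iff]
    exact isAlgebraic_algebraMap
      (⟨_, Algebra.subset_adjoin ⟨i, rfl⟩⟩ : Algebra.adjoin k (Set.range fun i ↦ (xv k n i)⁻¹))
  exact (Algebra.IsAlgebraic.isTranscendenceBasis_of_le_trdeg_of_finite k _
    (xv_algebraicIndependent k n).cardinalMk_le_trdeg).1

lemma exists_RF_algHom {k : Type} [Field k] {n : ℕ} {y : Fin n → RF k n}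
    (hy : AlgebraicIndependent k y) : ∃ f : RF k n →ₐ[k] RF k n, ∀ i, f (xv k n i) = y i := by
  have hinj : Function.Injective (MvPolynomial.aeval (R := k) y) := hy
  refine ⟨IsFractionRing.liftAlgHom hinj, fun i ↦ ?_⟩
  rw [xv, IsFractionRing.liftAlgHom_apply, IsFractionRing.lift_algebraMap]
  exact MvPolynomial.aeval_X y i

lemma exists_RF_algEquiv_perm (k : Type) [Field k] {n : ℕ} (σ : Equiv.Perm (Fin n)) :
    ∃ f : RF k n ≃ₐ[k] RF k n, ∀ i, f (xv k n i) = xv k n (σ i) := by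
  obtain ⟨f, hf⟩ := exists_RF_algHom ((xv_algebraicIndependent k n).comp _ σ.injective)
  obtain ⟨g, hg⟩ := exists_RF_algHom ((xv_algebraicIndependent k n).comp _ σ.symm.injective)
  exact ⟨AlgEquiv.ofAlgHom f g (RF_algHom_ext fun i ↦ by simp [hf, hg])
    (RF_algHom_ext fun i ↦ by simp [hf, hg]), fun i ↦ by simp [hf]⟩

lemma exists_RF_algEquiv_inv (k : Type) [Field k] {n : ℕ} (σ : Equiv.Perm (Fin n)) :
    ∃ f : RF k n ≃ₐ[k] RF k n, ∀ i, f (xv k n i) = (xv k n (σ i))⁻¹ := by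
  obtain ⟨f, hf⟩ := exists_RF_algHom ((algebraicIndependent_xv_inv k n).comp _ σ.injective)
  obtain ⟨g, hg⟩ := exists_RF_algHom ((algebraicIndependent_xv_inv k n).comp _ σ.symm.injective)
  exact ⟨AlgEquiv.ofAlgHom f g (RF_algHom_ext fun i ↦ by simp [hf, hg])
    (RF_algHom_ext fun i ↦ by simp [hf, hg]), fun i ↦ by simp [hf]⟩

/-- The ratio `x_i / x_j` attached to an ordered pair `(i, j)` with `i ≠ j`. -/
def xratio (k : Type) [Field k] (n : ℕ) (p : {p : Fin n × Fin n // p.1 ≠ p.2}) : RF k n :=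
  xv k n p.1.1 / xv k n p.1.2

lemma range_xratio (k : Type) [Field k] (n : ℕ) : Set.range (xratio k n) = ratioSet k n := by
  ext z
  constructor
  · rintro ⟨⟨⟨i, j⟩, h⟩, rfl⟩
    exact ⟨i, j, h, rfl⟩
  · rintro ⟨i, j, h, rfl⟩
    exact ⟨⟨⟨i, j⟩, h⟩, rfl⟩

lemma sum_single_eq_of_xv_mul_eq {k : Type} [Field k] {n : ℕ} {a b c d p q : Fin n}
    (h : xv k n a * xv k n d * xv k n q = xv k n b * xv k n c * xv k n p) :
    (Finsupp.single a 1 + Finsupp.single d 1 + Finsupp.single q 1 : Fin n →₀ ℕ) =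
      Finsupp.single b 1 + Finsupp.single c 1 + Finsupp.single p 1 := by
  simp only [xv, ← map_mul] at h
  have h' := IsFractionRing.injective (MvPolynomial (Fin n) k) (RF k n) h
  simp only [MvPolynomial.X, MvPolynomial.monomial_mul, mul_one] at h'
  simpa [MvPolynomial.monomial_eq_monomial_iff] using h'

lemma fst_eq_or_snd_eq_of_xratio_mul {k : Type} [Field k] {n : ℕ}
    {u v w : {p : Fin n × Fin n // p.1 ≠ p.2}}
    (h : xratio k n u = xratio k n v * xratio k n w) :
    (u.1.1 = v.1.1 ∧ u.1.2 ≠ v.1.2) ∨ (u.1.2 = v.1.2 ∧ u.1.1 ≠ v.1.1) := by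
  obtain ⟨⟨a, b⟩, hab⟩ := u
  obtain ⟨⟨c, d⟩, hcd⟩ := v
  obtain ⟨⟨p, q⟩, hpq⟩ := w
  simp only [xratio] at h hab hcd hpq ⊢
  have h' : xv k n a * xv k n d * xv k n q = xv k n b * xv k n c * xv k n p := by
    have := xv_ne_zero k n b; have := xv_ne_zero k n d; have := xv_ne_zero k n q
    field_simp at h
    linear_combination h
  have hs := sum_single_eq_of_xv_mul_eq h'
  have ha := DFunLike.congr_fun hs a
  have hb := DFunLike.congr_fun hs b
  have hc := DFunLike.congr_fun hs c
  have hp := DFunLike.congr_fun hs p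
  have hq := DFunLike.congr_fun hs q
  clear hs h' h
  simp only [Finsupp.add_apply, Finsupp.single_apply] at ha hb hc hp hq
  grind

/-- Pairwise collinear points of a grid are collinear. -/
lemma forall_fst_eq_or_forall_snd_eq {ι α β : Type*} {s : Set ι} {f : ι → α × β}
    (h : ∀ i ∈ s, ∀ j ∈ s, i ≠ j →
      ((f i).1 = (f j).1 ∧ (f i).2 ≠ (f j).2) ∨ ((f i).2 = (f j).2 ∧ (f i).1 ≠ (f j).1)) :
    (∀ i ∈ s, ∀ j ∈ s, (f i).1 = (f j).1) ∨ (∀ i ∈ s, ∀ j ∈ s, (f i).2 = (f j).2) := by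
  by_contra! hc
  obtain ⟨⟨i, hi, j, hj, hij⟩, l, hl, m, hm, hlm⟩ := hc
  have h' : ∀ i ∈ s, ∀ j ∈ s, (f i).1 = (f j).1 ∨ (f i).2 = (f j).2 := fun i hi j hj ↦ by
    rcases eq_or_ne i j with rfl | hij
    · exact .inl rfl
    · exact (h i hi j hj hij).imp And.left And.left
  have := (h l hl m hm fun e ↦ hlm (e ▸ rfl)).resolve_right fun e ↦ hlm e.1
  have := (h i hi j hj fun e ↦ hij (e ▸ rfl)).resolve_left fun e ↦ hij e.1
  have := h' i hi l hl
  have := h' i hi m hm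
  have := h' j hj l hl
  have := h' j hj m hm
  grind

/-- A multiplicative map on the ratios, sending ratios to ratios, comes from a permutation of the
variables, possibly followed by inversion. -/
lemma exists_perm_of_xratio_map {k : Type} [Field k] {n : ℕ} (i₀ : Fin n)
    (g : Fin n → Fin n → RF k n) (hself : ∀ i, g i i = 1)
    (hmul : ∀ i j l, g i j = g i l * g l j)
    (hrat : ∀ i j, i ≠ j → ∃ p, g i j = xratio k n p) :
    ∃ σ : Equiv.Perm (Fin n), (∀ i j, g i j = xv k n (σ i) / xv k n (σ j)) ∨
      (∀ i j, g i j = (xv k n (σ i))⁻¹ / (xv k n (σ j))⁻¹) := by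
  by_cases hn : ∃ j₀, j₀ ≠ i₀
  swap
  · push Not at hn
    refine ⟨1, .inl fun i j ↦ ?_⟩
    rw [hn i, hn j, hself, div_self (xv_ne_zero _ _ _)]
  obtain ⟨j₀, hj₀⟩ := hn
  have hrat' : ∀ j, ∃ p, j ≠ i₀ → g i₀ j = xratio k n p := fun j ↦ by
    by_cases hj : j = i₀
    · obtain ⟨p, -⟩ := hrat j₀ i₀ hj₀
      exact ⟨p, fun h ↦ (h hj).elim⟩
    · obtain ⟨p, hp⟩ := hrat i₀ j (Ne.symm hj)
      exact ⟨p, fun _ ↦ hp⟩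
  choose f hf using hrat'
  have hcol : ∀ i ∈ {i | i ≠ i₀}, ∀ j ∈ {i | i ≠ i₀}, i ≠ j →
      ((f i).1.1 = (f j).1.1 ∧ (f i).1.2 ≠ (f j).1.2) ∨
      ((f i).1.2 = (f j).1.2 ∧ (f i).1.1 ≠ (f j).1.1) := fun i hi j hj hij ↦ by
    obtain ⟨w, hw⟩ := hrat j i hij.symm
    refine fst_eq_or_snd_eq_of_xratio_mul (k := k) (w := w) ?_
    rw [← hf i hi, ← hf j hj, ← hw, ← hmul]
  have hdiv : ∀ i j, g i j = g i₀ j / g i₀ i := fun i j ↦ by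
    have h1 : g i₀ i * g i i₀ = 1 := by rw [← hmul, hself]
    rw [hmul i j i₀, eq_div_iff (left_ne_zero_of_mul_eq_one h1)]
    linear_combination g i₀ j * h1
  have hx := xv_ne_zero k n
  rcases forall_fst_eq_or_forall_snd_eq (f := fun i ↦ (f i).1) hcol with h | h
  · let s : Fin n → Fin n := fun j ↦ if j = i₀ then (f j₀).1.1 else (f j).1.2
    have hs : Function.Injective s := fun i j hij ↦ by
      by_contra hne
      simp only [s] at hij
      split_ifs at hij with hi hj hj
      · exact hne (hi.trans hj.symm)
      · exact (f j).2 ((h j hj j₀ hj₀).trans hij)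
      · exact (f i).2 ((h i hi j₀ hj₀).trans hij.symm)
      · rcases hcol i hi j hj hne with ⟨h1, h2⟩ | ⟨h1, h2⟩
        · exact h2 hij
        · exact h2 (h i hi j hj)
    have hg : ∀ j, g i₀ j = xv k n (s i₀) / xv k n (s j) := fun j ↦ by
      by_cases hj : j = i₀
      · rw [hj, hself, div_self (hx _)]
      · rw [hf j hj, xratio]
        simp only [s, hj, if_true, if_false]
        rw [h j hj j₀ hj₀]
    refine ⟨.ofBijective s (Finite.injective_iff_bijective.mp hs), .inl fun i j ↦ ?_⟩
    rw [hdiv, hg, hg]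
    have := hx (s i); have := hx (s j); have := hx (s i₀)
    simp only [Equiv.ofBijective_apply]
    field_simp
  · let s : Fin n → Fin n := fun j ↦ if j = i₀ then (f j₀).1.2 else (f j).1.1
    have hs : Function.Injective s := fun i j hij ↦ by
      by_contra hne
      simp only [s] at hij
      split_ifs at hij with hi hj hj
      · exact hne (hi.trans hj.symm)
      · exact (f j).2 (hij.symm.trans (h j₀ hj₀ j hj))
      · exact (f i).2 (hij.trans (h j₀ hj₀ i hi))
      · rcases hcol i hi j hj hne with ⟨h1, h2⟩ | ⟨h1, h2⟩
        · exact h2 (h i hi j hj)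
        · exact h2 hij
    have hg : ∀ j, g i₀ j = xv k n (s j) / xv k n (s i₀) := fun j ↦ by
      by_cases hj : j = i₀
      · rw [hj, hself, div_self (hx _)]
      · rw [hf j hj, xratio]
        simp only [s, hj, if_true, if_false]
        rw [h j hj j₀ hj₀]
    refine ⟨.ofBijective s (Finite.injective_iff_bijective.mp hs), .inr fun i j ↦ ?_⟩
    rw [hdiv, hg, hg]
    have := hx (s i); have := hx (s j); have := hx (s i₀)
    simp only [Equiv.ofBijective_apply]
    field_simp

lemma sum_xratio_pow (k : Type) [Field k] (n r : ℕ) :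
    ∑ p, xratio k n p ^ r = qObs k n r - n := by
  have h1 : qObs k n r = ∑ p : Fin n × Fin n, (xv k n p.1 / xv k n p.2) ^ r := by
    rw [qObs, Finset.sum_mul_sum, ← Finset.univ_product_univ, Finset.sum_product]
    simp [div_eq_mul_inv, mul_pow]
  have h2 : ∑ p : {p : Fin n × Fin n // ¬ p.1 ≠ p.2}, (xv k n p.1.1 / xv k n p.1.2) ^ r = n := by
    have h3 : ∀ p : {p : Fin n × Fin n // ¬ p.1 ≠ p.2},
        (xv k n p.1.1 / xv k n p.1.2) ^ r = 1 := fun p ↦ by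
      rw [not_not.mp p.2, div_self (xv_ne_zero _ _ _), one_pow]
    rw [Finset.sum_congr rfl fun p _ ↦ h3 p, Finset.sum_const, nsmul_one, Finset.card_univ,
      Fintype.card_subtype]
    congr 1
    have : Finset.univ.filter (fun p : Fin n × Fin n ↦ ¬ p.1 ≠ p.2) = Finset.univ.diag := by
      ext p; simp [Finset.mem_diag]
    rw [this, Finset.diag_card, Finset.card_univ, Fintype.card_fin]
  rw [h1, ← Fintype.sum_subtype_add_sum_subtype (fun p : Fin n × Fin n ↦ p.1 ≠ p.2), h2,
    add_sub_cancel_right]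
  rfl

lemma card_offDiag_subtype (n : ℕ) :
    Fintype.card {p : Fin n × Fin n // p.1 ≠ p.2} = n * (n - 1) := by
  rw [Fintype.card_subtype]
  have : Finset.univ.filter (fun p : Fin n × Fin n ↦ p.1 ≠ p.2) = Finset.univ.offDiag := by
    ext p; simp [Finset.mem_offDiag]
  rw [this, Finset.offDiag_card, Finset.card_univ, Fintype.card_fin, Nat.mul_sub_one]

lemma prod_xratio (k : Type) [Field k] (n : ℕ) : ∏ p, xratio k n p = 1 := by
  let e : {p : Fin n × Fin n // p.1 ≠ p.2} ≃ {p : Fin n × Fin n // p.1 ≠ p.2} :=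
    (Equiv.prodComm _ _).subtypeEquiv fun _ ↦ ne_comm
  have h : ∏ p : {p : Fin n × Fin n // p.1 ≠ p.2}, xv k n p.1.1 = ∏ p, xv k n (e p).1.1 :=
    (e.prod_comp fun p ↦ xv k n p.1.1).symm
  simp only [xratio, Finset.prod_div_distrib]
  rw [h]
  exact div_self (Finset.prod_ne_zero_iff.mpr fun p _ ↦ xv_ne_zero k n _)

lemma sum_powersetCard_prod_xratio_symm (k : Type) [Field k] (n : ℕ) {m : ℕ}
    (hm : m ≤ n * (n - 1)) :
    ∑ t ∈ Finset.powersetCard m Finset.univ, ∏ p ∈ t, xratio k n p =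
      ∑ t ∈ Finset.powersetCard (n * (n - 1) - m) Finset.univ, ∏ p ∈ t, xratio k n p := by
  let e : {p : Fin n × Fin n // p.1 ≠ p.2} ≃ {p : Fin n × Fin n // p.1 ≠ p.2} :=
    (Equiv.prodComm _ _).subtypeEquiv fun _ ↦ ne_comm
  have he : ∀ p, e.symm (e.symm p) = p := fun p ↦ rfl
  have hinv : ∀ p, xratio k n (e p) = (xratio k n p)⁻¹ := fun p ↦ by
    rw [xratio, xratio, inv_div]
    rfl
  have hcard := card_offDiag_subtype n
  refine Finset.sum_nbij' (fun t ↦ tᶜ.map e.toEmbedding) (fun t ↦ tᶜ.map e.toEmbedding)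
    ?_ ?_ ?_ ?_ ?_
  · intro t ht
    simp only [Finset.mem_powersetCard_univ, Finset.card_map, Finset.card_compl] at ht ⊢
    rw [ht, hcard]
  · intro t ht
    simp only [Finset.mem_powersetCard_univ, Finset.card_map, Finset.card_compl] at ht ⊢
    omega
  · intro t _
    ext p
    simp [Finset.mem_map_equiv, Finset.mem_compl, he]
  · intro t _
    ext p
    simp [Finset.mem_map_equiv, Finset.mem_compl, he]
  · intro t _
    rw [Finset.prod_map]
    simp only [Equiv.coe_toEmbedding, hinv, Finset.prod_inv_distrib]
    refine eq_inv_of_mul_eq_one_left ?_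
    rw [Finset.prod_mul_prod_compl, prod_xratio]

lemma esymm_mem_of_psum_mem {k F ι : Type*} [Field k] [Field F] [CharZero F] [Algebra k F]
    [Fintype ι] (K : IntermediateField k F) (y : ι → F) (M : ℕ)
    (h : ∀ r, 1 ≤ r → r ≤ M → ∑ i, y i ^ r ∈ K) {m : ℕ} (hm : m ≤ M) :
    ∑ t ∈ Finset.powersetCard m Finset.univ, ∏ i ∈ t, y i ∈ K := by
  have hes (m : ℕ) : ∑ t ∈ Finset.powersetCard m Finset.univ, ∏ i ∈ t, y i =
      MvPolynomial.aeval y (MvPolynomial.esymm ι k m) := by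
    simp [MvPolynomial.esymm]
  rw [hes]
  induction m using Nat.strong_induction_on with
  | _ m ih =>
    rcases Nat.eq_zero_or_pos m with rfl | hpos
    · simp [MvPolynomial.esymm_zero]
    have hN := congrArg (MvPolynomial.aeval y) (MvPolynomial.mul_esymm_eq_sum ι k m)
    rw [map_mul, map_natCast, mul_comm] at hN
    rw [eq_div_of_mul_eq (Nat.cast_ne_zero.mpr hpos.ne') hN]
    refine div_mem ?_ (natCast_mem K m)
    simp only [map_mul, map_sum, map_pow, map_neg, map_one]
    have hneg : (-1 : F) ∈ K := neg_mem (one_mem K)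
    refine mul_mem (pow_mem hneg _) (sum_mem fun a ha ↦ ?_)
    rw [Finset.mem_filter, Finset.HasAntidiagonal.mem_antidiagonal] at ha
    refine mul_mem (mul_mem (pow_mem hneg _) (ih _ ha.2 (by omega))) ?_
    simpa [MvPolynomial.psum] using h a.2 (by omega) (by omega)

lemma qObs_mem_InvF (k : Type) [Field k] (n r : ℕ) : qObs k n r ∈ InvF k n := by
  rw [InvF, IntermediateField.mem_inf]
  constructor
  · rw [← sub_add_cancel (qObs k n r) (n : RF k n), ← sum_xratio_pow]
    refine add_mem (sum_mem fun p _ ↦ pow_mem (IntermediateField.subset_adjoin _ _ ?_) _)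
      (natCast_mem _ _)
    rw [← range_xratio]
    exact ⟨p, rfl⟩
  · rw [IntermediateField.mem_fixedField_iff]
    suffices h : Gsub k n ≤ MulAction.stabilizer (RF k n ≃ₐ[k] RF k n) (qObs k n r) from
      fun f hf ↦ h hf
    rw [Gsub, Subgroup.closure_le]
    rintro φ ⟨σ, h | h⟩
    · change φ (qObs k n r) = qObs k n r
      simp only [qObs, map_mul, map_sum, map_zpow₀, h]
      rw [Equiv.sum_comp σ fun i ↦ xv k n i ^ (r : ℤ),
        Equiv.sum_comp σ fun i ↦ xv k n i ^ (-r : ℤ)]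
    · change φ (qObs k n r) = qObs k n r
      simp only [qObs, map_mul, map_sum, map_zpow₀, h, inv_zpow', neg_neg]
      rw [Equiv.sum_comp σ fun i ↦ xv k n i ^ (r : ℤ),
        Equiv.sum_comp σ fun i ↦ xv k n i ^ (-r : ℤ), mul_comm]

lemma exists_map_eq_prod_X_sub_C_xratio {k : Type} [Field k] [CharZero k] {n : ℕ}
    (K : IntermediateField k (RF k n))
    (hK : ∀ r : ℕ, 1 ≤ r → r ≤ n * (n - 1) / 2 → qObs k n r ∈ K) :
    ∃ P : Polynomial K, P.map (algebraMap K (RF k n)) =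
      ∏ p, (Polynomial.X - Polynomial.C (xratio k n p)) := by
  have : CharZero (RF k n) := charZero_of_injective_algebraMap (algebraMap k (RF k n)).injective
  have hlow {m : ℕ} (hm : m ≤ n * (n - 1) / 2) := esymm_mem_of_psum_mem K (xratio k n) _
    (fun r h1 h2 ↦ by
      rw [sum_xratio_pow]
      exact sub_mem (hK r h1 h2) (natCast_mem K n)) hm
  have hall {m : ℕ} (hm : m ≤ n * (n - 1)) :
      ∑ t ∈ Finset.powersetCard m Finset.univ, ∏ i ∈ t, xratio k n i ∈ K := by
    rcases le_or_gt m (n * (n - 1) / 2) with h | h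
    · exact hlow h
    · rw [sum_powersetCard_prod_xratio_symm k n hm]
      exact hlow (by have := Nat.even_mul_pred_self n; grind)
  rw [← Polynomial.mem_lifts, Polynomial.lifts_iff_coeff_lifts]
  intro m
  suffices h : (∏ p, (Polynomial.X - Polynomial.C (xratio k n p))).coeff m ∈ K from ⟨⟨_, h⟩, rfl⟩
  have hcard : (Finset.univ.val.map (xratio k n)).card = n * (n - 1) := by
    rw [Multiset.card_map, Finset.card_val, Finset.card_univ, card_offDiag_subtype]
  have hprod : ∏ p, (Polynomial.X - Polynomial.C (xratio k n p)) =
      ((Finset.univ.val.map (xratio k n)).map fun t ↦ Polynomial.X - Polynomial.C t).prod := by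
    rw [Multiset.map_map]
    rfl
  rw [hprod]
  rcases le_or_gt m (n * (n - 1)) with h | h
  · rw [Multiset.prod_X_sub_C_coeff _ (hcard ▸ h), hcard, Finset.esymm_map_val]
    exact mul_mem (pow_mem (neg_mem (one_mem K)) _) (hall (Nat.sub_le _ _))
  · rw [Polynomial.coeff_eq_zero_of_natDegree_lt]
    · exact zero_mem K
    · rwa [Polynomial.natDegree_multiset_prod_X_sub_C_eq_card, hcard]

section AdjoinRoots

variable {K L ι : Type*} [Field K] [Field L] [Algebra K L] [Fintype ι] {y : ι → L}
  {P : Polynomial K}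

lemma aeval_eq_zero_iff_of_map_eq_prod
    (hP : P.map (algebraMap K L) = ∏ i, (Polynomial.X - Polynomial.C (y i))) (z : L) :
    Polynomial.aeval z P = 0 ↔ z ∈ Set.range y := by
  rw [← Polynomial.eval_map_algebraMap, hP, Polynomial.eval_prod, Finset.prod_eq_zero_iff]
  simp [sub_eq_zero, eq_comm]

lemma isSplittingField_adjoin_of_map_eq_prod
    (hP : P.map (algebraMap K L) = ∏ i, (Polynomial.X - Polynomial.C (y i))) :
    P.IsSplittingField K (IntermediateField.adjoin K (Set.range y)) := by
  have hroots : P.rootSet L = Set.range y := by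
    ext z
    rw [Polynomial.mem_rootSet', aeval_eq_zero_iff_of_map_eq_prod hP, hP,
      and_iff_right (Polynomial.monic_prod_X_sub_C _ _).ne_zero]
  rw [← hroots]
  refine IntermediateField.adjoin_rootSet_isSplittingField ?_
  rw [hP]
  exact Polynomial.Splits.prod fun i _ ↦ Polynomial.Splits.X_sub_C _

lemma isGalois_adjoin_of_map_eq_prod [CharZero K]
    (hP : P.map (algebraMap K L) = ∏ i, (Polynomial.X - Polynomial.C (y i))) :
    IsGalois K (IntermediateField.adjoin K (Set.range y)) := by
  have := isSplittingField_adjoin_of_map_eq_prod hP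
  have hnormal := Normal.of_isSplittingField (E := IntermediateField.adjoin K (Set.range y)) P
  exact isGalois_iff.mpr ⟨inferInstance, hnormal⟩

lemma algEquiv_apply_mem_range_of_map_eq_prod
    (hP : P.map (algebraMap K L) = ∏ i, (Polynomial.X - Polynomial.C (y i)))
    {E : IntermediateField K L} (φ : E ≃ₐ[K] E) {z : E} (hz : (z : L) ∈ Set.range y) :
    (φ z : L) ∈ Set.range y := by
  rw [← aeval_eq_zero_iff_of_map_eq_prod hP] at hz ⊢
  rw [← IntermediateField.coe_val E, Polynomial.aeval_algHom_apply, map_eq_zero] at hz ⊢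
  rw [← AlgEquiv.coe_toAlgHom, Polynomial.aeval_algHom_apply, hz, map_zero]

end AdjoinRoots

lemma InvF_le_of_qObs_mem {k : Type} [Field k] [CharZero k] {n : ℕ} [NeZero n]
    (K : IntermediateField k (RF k n)) (hKG : K ≤ IntermediateField.fixedField (Gsub k n))
    (hK : ∀ r : ℕ, 1 ≤ r → r ≤ n * (n - 1) / 2 → qObs k n r ∈ K) : InvF k n ≤ K := by
  obtain ⟨P, hP⟩ := exists_map_eq_prod_X_sub_C_xratio K hK
  set E := IntermediateField.adjoin K (Set.range (xratio k n))
  have hchar : CharZero K := charZero_of_injective_algebraMap (algebraMap k K).injective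
  have hfin : FiniteDimensional K E :=
    have := isSplittingField_adjoin_of_map_eq_prod hP
    Polynomial.IsSplittingField.finiteDimensional E P
  have hgal : IsGalois K E := isGalois_adjoin_of_map_eq_prod hP
  have hxE (i j : Fin n) : xv k n i / xv k n j ∈ E := by
    by_cases h : i = j
    · rw [h, div_self (xv_ne_zero k n j)]
      exact one_mem E
    · exact IntermediateField.subset_adjoin _ _ ⟨⟨(i, j), h⟩, rfl⟩
  have hext (φ : E ≃ₐ[K] E) : ∃ ψ ∈ Gsub k n, ∀ z : E, ψ z = φ z := by
    obtain ⟨σ, hσ⟩ := exists_perm_of_xratio_map (k := k) 0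
      (fun i j ↦ (φ ⟨_, hxE i j⟩ : RF k n))
      (fun i ↦ by
        have : (⟨_, hxE i i⟩ : E) = 1 := Subtype.ext (div_self (xv_ne_zero k n i))
        rw [this, map_one]
        rfl)
      (fun i j l ↦ by
        have : (⟨_, hxE i j⟩ : E) = ⟨_, hxE i l⟩ * ⟨_, hxE l j⟩ :=
          Subtype.ext (div_mul_div_cancel₀ (xv_ne_zero k n l)).symm
        rw [this, map_mul]
        rfl)
      (fun i j hij ↦ by
        obtain ⟨p, hp⟩ := algEquiv_apply_mem_range_of_map_eq_prod hP φ
          (z := ⟨_, hxE i j⟩) ⟨⟨(i, j), hij⟩, rfl⟩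
        exact ⟨p, hp.symm⟩)
    obtain ⟨ψ, hψG, hψ⟩ : ∃ ψ ∈ Gsub k n, ∀ i j,
        ψ (xv k n i / xv k n j) = φ ⟨_, hxE i j⟩ := by
      rcases hσ with h | h
      · obtain ⟨ψ, hψ⟩ := exists_RF_algEquiv_perm k σ
        exact ⟨ψ, Subgroup.subset_closure ⟨σ, .inl hψ⟩, fun i j ↦ by rw [h, map_div₀, hψ, hψ]⟩
      · obtain ⟨ψ, hψ⟩ := exists_RF_algEquiv_inv k σ
        exact ⟨ψ, Subgroup.subset_closure ⟨σ, .inr hψ⟩, fun i j ↦ by rw [h, map_div₀, hψ, hψ]⟩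
    refine ⟨ψ, hψG, fun ⟨z, hz⟩ ↦ ?_⟩
    induction hz using IntermediateField.adjoin_induction with
    | mem z hz =>
      obtain ⟨p, rfl⟩ := hz
      exact hψ _ _
    | algebraMap c =>
      have : (⟨algebraMap K (RF k n) c, E.algebraMap_mem c⟩ : E) = algebraMap K E c := rfl
      rw [this, φ.commutes]
      exact hKG c.2 ⟨ψ, hψG⟩
    | add x y hx hy ihx ihy =>
      have : (⟨x + y, add_mem hx hy⟩ : E) = ⟨x, hx⟩ + ⟨y, hy⟩ := rfl
      rw [this, map_add]
      simpa using congrArg₂ (· + ·) ihx ihy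
    | inv x hx ihx =>
      have : (⟨x⁻¹, inv_mem hx⟩ : E) = ⟨x, hx⟩⁻¹ := rfl
      rw [this, map_inv₀]
      simpa using congrArg (·⁻¹) ihx
    | mul x y hx hy ihx ihy =>
      have : (⟨x * y, mul_mem hx hy⟩ : E) = ⟨x, hx⟩ * ⟨y, hy⟩ := rfl
      rw [this, map_mul]
      simpa using congrArg₂ (· * ·) ihx ihy
  intro f hf
  rw [InvF, IntermediateField.mem_inf, IntermediateField.mem_fixedField_iff] at hf
  have hfE : f ∈ E := by
    have hle : IntermediateField.adjoin k (ratioSet k n) ≤ E.restrictScalars k := by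
      rw [IntermediateField.adjoin_le_iff, ← range_xratio]
      exact IntermediateField.subset_adjoin _ _
    exact hle hf.1
  obtain ⟨c, hc⟩ := (IsGalois.mem_range_algebraMap_iff_fixed (F := K) (⟨f, hfE⟩ : E)).mpr fun φ ↦ by
    obtain ⟨ψ, hψG, hψ⟩ := hext φ
    exact Subtype.ext ((hψ ⟨f, hfE⟩).symm.trans (hf.2 ψ hψG))
  have hcf : (c : RF k n) = f := congrArg Subtype.val hc
  exact hcf ▸ c.2

theorem stmt0 (k : Type) [Field k] [CharZero k] (n : ℕ) (hn : 2 ≤ n) :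
    InvF k n =
      IntermediateField.adjoin k
        {q | ∃ r : ℕ, 1 ≤ r ∧ r ≤ n * (n - 1) / 2 ∧ q = qObs k n (r : ℤ)} := by
  have : NeZero n := ⟨by omega⟩
  have hle : IntermediateField.adjoin k
      {q | ∃ r : ℕ, 1 ≤ r ∧ r ≤ n * (n - 1) / 2 ∧ q = qObs k n (r : ℤ)} ≤ InvF k n := by
    rw [IntermediateField.adjoin_le_iff]
    rintro _ ⟨r, -, -, rfl⟩
    exact qObs_mem_InvF k n r
  exact le_antisymm (InvF_le_of_qObs_mem _ (hle.trans inf_le_right) fun r h1 h2 ↦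
    IntermediateField.subset_adjoin _ _ ⟨r, h1, h2, rfl⟩) hle
end
end

section
/- Let n ≥ 3. A permutation h of the N-element set Λ preserves both adjacency and opposition if and only if h lies in the image of G = S_n × T in Sym(Λ). -/
/-- `Λ` is the set of off-diagonal positions in an `n × n` array. -/
abbrev Lam (n : ℕ) := {p : Fin n × Fin n // p.1 ≠ p.2}

/-- `(i,j)` and `(i',j')` are opposite if `i = j'` and `j = i'`. -/
def Opposite' {n : ℕ} (a b : Lam n) : Prop :=
  a.1.1 = b.1.2 ∧ a.1.2 = b.1.1

/-- `(i,j)` and `(i',j')` are adjacent if exactly one of the equalities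
`i = j'`, `j = i'` holds. -/
def Adjacent' {n : ℕ} (a b : Lam n) : Prop :=
  (a.1.1 = b.1.2 ∧ a.1.2 ≠ b.1.1) ∨ (a.1.1 ≠ b.1.2 ∧ a.1.2 = b.1.1)

/-- Membership in the image of `G = S_n × T` in `Sym(Λ)`: `h` is induced by a
permutation `σ ∈ S_n` acting simultaneously on rows and columns, possibly
composed with transposition `τ`. -/
def InG {n : ℕ} (h : Equiv.Perm (Lam n)) : Prop :=
  ∃ σ : Equiv.Perm (Fin n), ∃ t : Bool, ∀ a : Lam n,
    ((h a : Fin n × Fin n)) =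
      if t then (σ a.1.2, σ a.1.1) else (σ a.1.1, σ a.1.2)

/-- A function of ordered pairs that depends only on the first entry, and takes different values on
opposite pairs, comes from a permutation. -/
theorem exists_perm_of_first_entry {n : ℕ} (hn : 3 ≤ n) (p : Fin n → Fin n → Fin n)
    (hne : ∀ i j, i ≠ j → p i j ≠ p j i)
    (hp : ∀ i j k, i ≠ j → j ≠ k → i ≠ k → p j i = p j k) :
    ∃ σ : Equiv.Perm (Fin n), ∀ i j, i ≠ j → p i j = σ i := by
  have : Nontrivial (Fin n) := Fin.nontrivial_iff_two_le.mpr (by omega)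
  have hs : ∀ i, ∃ s, ∀ j, i ≠ j → p i j = s := by
    intro i
    obtain ⟨k, hk⟩ := exists_ne i
    refine ⟨p i k, fun j hj => ?_⟩
    by_cases hjk : j = k
    · rw [hjk]
    · exact hp j i k hj.symm hk.symm hjk
  choose σ hσ using hs
  have hinj : Function.Injective σ := by
    intro i j hij
    by_contra hne'
    exact hne i j hne' (by rw [hσ i j hne', hσ j i (Ne.symm hne'), hij])
  exact ⟨Equiv.ofBijective σ (Finite.injective_iff_bijective.mp hinj), fun i j hij => hσ i j hij⟩

/-- If `(i, j) ↦ (p i j, p j i)` preserves adjacency, then it either preserves the direction of all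
adjacencies or reverses the direction of all of them. -/
theorem forall_forward_or_forall_backward {n : ℕ} (p : Fin n → Fin n → Fin n)
    (hne : ∀ i j, i ≠ j → p i j ≠ p j i)
    (hadj : ∀ i j k, i ≠ j → j ≠ k → i ≠ k →
      (p i j = p k j ∧ p j i ≠ p j k) ∨ (p i j ≠ p k j ∧ p j i = p j k)) :
    (∀ i j k, i ≠ j → j ≠ k → i ≠ k → p j i = p j k) ∨
      (∀ i j k, i ≠ j → j ≠ k → i ≠ k → p i j = p k j) := by
  have rot : ∀ i j k, i ≠ j → j ≠ k → i ≠ k → p j i = p j k → p k j = p k i := by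
    intro i j k hij hjk hik h
    have h1 := hadj j k i hjk hik.symm hij.symm
    have h2 := hadj k i j hik.symm hij hjk.symm
    have h3 := hne i k hik
    have h4 := hne i j hij
    grind
  have replace_last : ∀ i j k l, i ≠ j → j ≠ k → i ≠ k → i ≠ l → j ≠ l →
      p j i = p j k → p j i = p j l := by
    intro i j k l hij hjk hik hil hjl h
    by_cases hkl : k = l
    · rw [← hkl, h]
    have h1 := hadj i j k hij hjk hik
    have h2 := hadj i j l hij hjl hil
    have h3 := hadj k j l hjk.symm hjl hkl
    grind
  by_cases hF : ∃ a b c, a ≠ b ∧ b ≠ c ∧ a ≠ c ∧ p b a = p b c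
  · left
    obtain ⟨a, b, c, hab, hbc, hac, h⟩ := hF
    have fix_two : ∀ l, a ≠ l → b ≠ l → p b a = p b l := fun l hal hbl =>
      replace_last a b c l hab hbc hac hal hbl h
    have fix_one : ∀ m l, a ≠ m → a ≠ l → m ≠ l → p m a = p m l := by
      intro m l ham hal hml
      by_cases hmb : m = b
      · subst hmb; exact fix_two l hal hml
      have hm := rot a b m hab (Ne.symm hmb) ham (fix_two m ham (Ne.symm hmb))
      exact replace_last a m b l ham hmb hab hal hml hm.symm
    intro i j k hij hjk hik
    by_cases hja : j = a
    · subst hja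
      exact rot k i j hik.symm hij hjk.symm (fix_one i k hij.symm hjk hik).symm
    by_cases hia : i = a
    · subst hia; exact fix_one j k hij hik hjk
    by_cases hka : k = a
    · subst hka; exact (fix_one j i (Ne.symm hja) (Ne.symm hia) hij.symm).symm
    rw [← fix_one j i (Ne.symm hja) (Ne.symm hia) hij.symm,
      fix_one j k (Ne.symm hja) (Ne.symm hka) hjk]
  · right
    intro i j k hij hjk hik
    rcases hadj i j k hij hjk hik with h | h
    · exact h.1
    · exact absurd ⟨i, j, k, hij, hjk, hik, h.2⟩ hF

theorem InG.preserves {n : ℕ} {h : Equiv.Perm (Lam n)} (hG : InG h) :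
    (∀ a b : Lam n, Adjacent' a b → Adjacent' (h a) (h b)) ∧
      (∀ a b : Lam n, Opposite' a b → Opposite' (h a) (h b)) := by
  obtain ⟨σ, t, hσ⟩ := hG
  refine ⟨fun a b hab => ?_, fun a b hab => ?_⟩
  · unfold Adjacent' at hab ⊢
    rw [hσ a, hσ b]
    cases t <;> simp <;> tauto
  · unfold Opposite' at hab ⊢
    rw [hσ a, hσ b]
    cases t <;> simp <;> tauto

theorem inG_of_preserves {n : ℕ} (hn : 3 ≤ n) {h : Equiv.Perm (Lam n)}
    (hadj : ∀ a b : Lam n, Adjacent' a b → Adjacent' (h a) (h b))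
    (hopp : ∀ a b : Lam n, Opposite' a b → Opposite' (h a) (h b)) : InG h := by
  let p : Fin n → Fin n → Fin n := fun i j =>
    if hij : i ≠ j then (h ⟨(i, j), hij⟩).1.1 else i
  have hp1 : ∀ i j (hij : i ≠ j), (h ⟨(i, j), hij⟩).1.1 = p i j := fun i j hij => by
    simp only [p, dif_pos hij]
  have hp2 : ∀ i j (hij : i ≠ j), (h ⟨(i, j), hij⟩).1.2 = p j i := fun i j hij => by
    rw [← hp1 j i hij.symm]
    exact (hopp ⟨(i, j), hij⟩ ⟨(j, i), hij.symm⟩ ⟨rfl, rfl⟩).2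
  have hne : ∀ i j, i ≠ j → p i j ≠ p j i := fun i j hij => by
    rw [← hp1 i j hij, ← hp2 i j hij]
    exact (h ⟨(i, j), hij⟩).2
  have hA : ∀ i j k, i ≠ j → j ≠ k → i ≠ k →
      (p i j = p k j ∧ p j i ≠ p j k) ∨ (p i j ≠ p k j ∧ p j i = p j k) := by
    intro i j k hij hjk hik
    have := hadj ⟨(i, j), hij⟩ ⟨(j, k), hjk⟩ (Or.inr ⟨hik, rfl⟩)
    unfold Adjacent' at this
    rwa [hp1, hp2, hp1, hp2] at this
  rcases forall_forward_or_forall_backward p hne hA with hF | hB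
  · obtain ⟨σ, hσ⟩ := exists_perm_of_first_entry hn p hne hF
    refine ⟨σ, false, ?_⟩
    rintro ⟨⟨i, j⟩, hij⟩
    exact Prod.ext ((hp1 i j hij).trans (hσ i j hij))
      ((hp2 i j hij).trans (hσ j i (Ne.symm hij)))
  · obtain ⟨σ, hσ⟩ := exists_perm_of_first_entry hn (fun i j => p j i)
      (fun i j hij => (hne i j hij).symm) hB
    refine ⟨σ, true, ?_⟩
    rintro ⟨⟨i, j⟩, hij⟩
    exact Prod.ext ((hp1 i j hij).trans (hσ j i (Ne.symm hij)))
      ((hp2 i j hij).trans (hσ i j hij))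

theorem stmt1 (n : ℕ) (hn : 3 ≤ n) (h : Equiv.Perm (Lam n)) :
    ((∀ a b : Lam n, Adjacent' a b → Adjacent' (h a) (h b)) ∧
      (∀ a b : Lam n, Opposite' a b → Opposite' (h a) (h b))) ↔ InG h :=
  ⟨fun hh => inG_of_preserves hn hh.1 hh.2, InG.preserves⟩
end

section
/- Let τ be the automorphism of the rational function field k(t_1, …, t_m) sending t_i to 1/t_i for every i = 1, …, m. Then the fixed field of τ is k(t_1, …, t_m)^τ = k(t_1 + 1/t_1, …, t_m + 1/t_m, t_1⋯t_m + 1/(t_1⋯t_m)). -/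
noncomputable section

open scoped Classical

abbrev RFm (k : Type) [Field k] (m : ℕ) := FractionRing (MvPolynomial (Fin m) k)

/-- The variable `t_i` in the rational function field `k(t_1, …, t_m)`. -/
def tv (k : Type) [Field k] (m : ℕ) (i : Fin m) : RFm k m :=
  algebraMap (MvPolynomial (Fin m) k) (RFm k m) (MvPolynomial.X i)

theorem tv_ne_zero (k : Type) [Field k] (m : ℕ) (i : Fin m) : tv k m i ≠ 0 := by
  unfold tv
  rw [Ne, FaithfulSMul.algebraMap_eq_zero_iff]
  exact MvPolynomial.X_ne_zero i

theorem intermediateField_eq_top_of_tv_mem {k : Type} [Field k] {m : ℕ}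
    (F : IntermediateField k (RFm k m)) (h : ∀ i, tv k m i ∈ F) : F = ⊤ := by
  have hpoly (p : MvPolynomial (Fin m) k) : algebraMap _ (RFm k m) p ∈ F := by
    induction p using MvPolynomial.induction_on with
    | C a =>
      rw [← MvPolynomial.algebraMap_eq, ← IsScalarTower.algebraMap_apply]
      exact F.algebraMap_mem a
    | add p q hp hq => rw [map_add]; exact F.add_mem hp hq
    | mul_X p i hp => rw [map_mul]; exact F.mul_mem hp (h i)
  rw [eq_top_iff]
  intro f _
  obtain ⟨a, b, -, rfl⟩ := IsFractionRing.div_surjective (A := MvPolynomial (Fin m) k) f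
  exact F.div_mem (hpoly a) (hpoly b)

theorem algHom_apply_eq_self_of_tv {k : Type} [Field k] {m : ℕ}
    (g : RFm k m →ₐ[k] RFm k m) (h : ∀ i, g (tv k m i) = tv k m i) (f : RFm k m) :
    g f = f := by
  have htop := intermediateField_eq_top_of_tv_mem
    { AlgHom.equalizer g (AlgHom.id k (RFm k m)) with
      inv_mem' := fun x (hx : g x = x) => show g x⁻¹ = x⁻¹ by rw [map_inv₀, hx] } h
  exact htop.ge (IntermediateField.mem_top (x := f))

/-- An endomorphism sending each variable to itself or its inverse and fixing the product of
all variables is the identity. -/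
theorem algHom_apply_eq_self_of_prod {k : Type} [Field k] {m : ℕ}
    (g : RFm k m →ₐ[k] RFm k m)
    (h : ∀ i, g (tv k m i) = tv k m i ∨ g (tv k m i) = (tv k m i)⁻¹)
    (hprod : g (∏ i, tv k m i) = ∏ i, tv k m i) (f : RFm k m) :
    g f = f := by
  refine algHom_apply_eq_self_of_tv g (fun j => ?_) f
  by_contra hj
  let p (i : Fin m) : MvPolynomial (Fin m) k :=
    if g (tv k m i) = tv k m i then 1 else MvPolynomial.X i ^ 2
  have hp (i : Fin m) : algebraMap _ (RFm k m) (p i) * g (tv k m i) = tv k m i := by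
    by_cases hi : g (tv k m i) = tv k m i
    · simp [p, hi]
    · have h0 := tv_ne_zero k m i
      simp only [p, if_neg hi, (h i).resolve_left hi, map_pow]
      change tv k m i ^ 2 * _ = _
      field_simp
  have hone : algebraMap _ (RFm k m) (∏ i, p i) = 1 := by
    have hne : ∏ i, tv k m i ≠ 0 := Finset.prod_ne_zero_iff.mpr fun i _ => tv_ne_zero k m i
    apply mul_right_cancel₀ hne
    rw [one_mul]
    conv_lhs => rw [← hprod]
    rw [map_prod, map_prod, ← Finset.prod_mul_distrib]
    exact Finset.prod_congr rfl fun i _ => hp i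
  have hone' : ∏ i, p i = 1 := by
    apply FaithfulSMul.algebraMap_injective (MvPolynomial (Fin m) k) (RFm k m)
    rw [hone, map_one]
  have hcoeff := congrArg (MvPolynomial.constantCoeff) hone'
  rw [map_prod, map_one, Finset.prod_eq_zero (Finset.mem_univ j) (by simp [p, hj])] at hcoeff
  exact zero_ne_one hcoeff

theorem eq_or_eq_inv_of_add_inv_eq {K : Type*} [Field K] {a b : K} (ha : a ≠ 0) (hb : b ≠ 0)
    (h : a + a⁻¹ = b + b⁻¹) : a = b ∨ a = b⁻¹ := by
  have h1 : (a - b) * (a * b - 1) = 0 := by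
    field_simp at h
    linear_combination h
  rcases mul_eq_zero.mp h1 with h2 | h2
  · exact Or.inl (sub_eq_zero.mp h2)
  · exact Or.inr (eq_inv_of_mul_eq_one_left (sub_eq_zero.mp h2))

open Polynomial in
/-- If `F` contains every `t_i + 1/t_i`, then `k(t_1, …, t_m)` is Galois over `F`. -/
theorem isGalois_of_tv_add_inv_mem {k : Type} [Field k] [CharZero k] {m : ℕ}
    (F : IntermediateField k (RFm k m)) (h : ∀ i, tv k m i + (tv k m i)⁻¹ ∈ F) :
    IsGalois F (RFm k m) := by
  have hgen : IntermediateField.adjoin F (Set.range (tv k m)) = ⊤ := by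
    have := intermediateField_eq_top_of_tv_mem
      ((IntermediateField.adjoin F (Set.range (tv k m))).restrictScalars k)
      fun i => IntermediateField.subset_adjoin F _ ⟨i, rfl⟩
    rwa [IntermediateField.restrictScalars_eq_top_iff] at this
  have hroot : ∀ x ∈ Set.range (tv k m),
      IsIntegral F x ∧ ((minpoly F x).map (algebraMap F (RFm k m))).Splits := by
    rintro _ ⟨i, rfl⟩
    have h0 := tv_ne_zero k m i
    let q : F[X] := X ^ 2 - C ⟨_, h i⟩ * X + 1
    have hmonic : q.Monic := by
      simp only [q]; monicity!
    have hmap : q.map (algebraMap F (RFm k m)) =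
        (X - C (tv k m i)) * (X - C (tv k m i)⁻¹) := by
      have hC : C (tv k m i) * C (tv k m i)⁻¹ = (1 : (RFm k m)[X]) := by
        rw [← C_mul, mul_inv_cancel₀ h0, C_1]
      simp only [q, Polynomial.map_add, Polynomial.map_sub, Polynomial.map_mul,
        Polynomial.map_pow, map_X, map_C, Polynomial.map_one,
        IntermediateField.algebraMap_apply, C_add]
      linear_combination -hC
    have hq : aeval (tv k m i) q = 0 := by
      rw [← eval_map_algebraMap, hmap]; simp
    refine ⟨⟨q, hmonic, hq⟩, ?_⟩
    refine Splits.of_dvd ?_ ?_ (Polynomial.map_dvd _ (minpoly.dvd F _ hq))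
    · rw [hmap]; exact (Splits.X_sub_C _).mul (Splits.X_sub_C _)
    · exact (hmonic.map _).ne_zero
  have halg : Algebra.IsAlgebraic F (RFm k m) := by
    have := IntermediateField.isAlgebraic_adjoin fun x hx => (hroot x hx).1
    rw [hgen] at this
    exact IntermediateField.topEquiv.isAlgebraic
  have hnormal : Normal F (RFm k m) :=
    ⟨fun x => IntermediateField.splits_of_mem_adjoin F (RFm k m) hroot (by rw [hgen]; trivial)⟩
  exact {}

/-- The fixed field of the involution `τ : t_i ↦ 1/t_i` of `k(t_1, …, t_m)` is
`k(t_1 + 1/t_1, …, t_m + 1/t_m, t_1⋯t_m + 1/(t_1⋯t_m))`. -/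
theorem stmt7 (k : Type) [Field k] [CharZero k] (m : ℕ)
    (τ : RFm k m ≃ₐ[k] RFm k m) (hτ : ∀ i, τ (tv k m i) = (tv k m i)⁻¹)
    (f : RFm k m) :
    τ f = f ↔
      f ∈ IntermediateField.adjoin k
        ({a | ∃ i : Fin m, a = tv k m i + (tv k m i)⁻¹} ∪
          {(∏ i, tv k m i) + (∏ i, tv k m i)⁻¹}) := by
  have hP0 : ∏ i, tv k m i ≠ 0 := Finset.prod_ne_zero_iff.mpr fun i _ => tv_ne_zero k m i
  set P := ∏ i, tv k m i with hP
  have hτP : τ P = P⁻¹ := by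
    rw [hP, map_prod, ← Finset.prod_inv_distrib]
    exact Finset.prod_congr rfl fun i _ => hτ i
  set F := IntermediateField.adjoin k
    ({a | ∃ i : Fin m, a = tv k m i + (tv k m i)⁻¹} ∪ {P + P⁻¹}) with hF
  have hsF (i : Fin m) : tv k m i + (tv k m i)⁻¹ ∈ F :=
    IntermediateField.subset_adjoin k _ (Or.inl ⟨i, rfl⟩)
  have hPF : P + P⁻¹ ∈ F := IntermediateField.subset_adjoin k _ (Or.inr rfl)
  constructor
  · intro hf
    have := isGalois_of_tv_add_inv_mem F hsF
    have hfix : ∀ σ : RFm k m ≃ₐ[F] RFm k m, σ f = f := by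
      intro σ
      have hσ {a : RFm k m} (ha : a ≠ 0) (haF : a + a⁻¹ ∈ F) : σ a = a ∨ σ a = a⁻¹ := by
        refine eq_or_eq_inv_of_add_inv_eq (by simpa using ha) ha ?_
        rw [← map_inv₀, ← map_add]
        exact σ.commutes ⟨_, haF⟩
      have hσt (i : Fin m) := hσ (tv_ne_zero k m i) (hsF i)
      rcases hσ hP0 hPF with h | h
      · exact algHom_apply_eq_self_of_prod (σ.restrictScalars k).toAlgHom hσt h f
      · apply τ.injective
        rw [hf]
        refine algHom_apply_eq_self_of_prod
          (τ.toAlgHom.comp (σ.restrictScalars k).toAlgHom) (fun i => ?_) ?_ f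
        · change τ (σ _) = _ ∨ τ (σ _) = _
          rcases hσt i with h | h
          · rw [h]; exact Or.inr (hτ i)
          · rw [h, map_inv₀, hτ, inv_inv]; exact Or.inl rfl
        · change τ (σ P) = P
          rw [h, map_inv₀, hτP, inv_inv]
    obtain ⟨y, rfl⟩ := (InfiniteGalois.mem_range_algebraMap_iff_fixed f).mpr hfix
    exact y.2
  · intro hf
    induction hf using IntermediateField.adjoin_induction with
    | mem x hx =>
      rcases hx with ⟨i, rfl⟩ | rfl
      · rw [map_add, map_inv₀, hτ, inv_inv, add_comm]
      · rw [map_add, map_inv₀, hτP, inv_inv, add_comm]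
    | algebraMap x => exact τ.commutes x
    | add x y _ _ hx hy => rw [map_add, hx, hy]
    | inv x _ hx => rw [map_inv₀, hx]
    | mul x y _ _ hx hy => rw [map_mul, hx, hy]
end
end

section
/- For n = 4, the subsemigroup S of ℤ^4 consisting of all a = (a_1, a_2, a_3, a_4) with a_1 + a_2 + a_3 + a_4 = 0, a_1 ≥ a_2 ≥ a_3 ≥ a_4, and (a_1, a_2, a_3, a_4) ⪰ (−a_4, −a_3, −a_2, −a_1) lexicographically, is generated as a semigroup by the four elements (1, 0, 0, −1), (2, 0, −1, −1), (3, −1, −1, −1), and (1, 1, −1, −1). -/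
/-- For `n = 4`, the semigroup `S ⊂ ℤ⁴` of weakly decreasing integer vectors
`(a₁,a₂,a₃,a₄)` with `a₁+a₂+a₃+a₄ = 0` and `(a₁,a₂,a₃,a₄) ⪰ (−a₄,−a₃,−a₂,−a₁)`
in the lexicographic order is generated by `(1,0,0,−1)`, `(2,0,−1,−1)`,
`(3,−1,−1,−1)` and `(1,1,−1,−1)`. -/
theorem stmt10 (a₁ a₂ a₃ a₄ : ℤ) :
    (a₁ + a₂ + a₃ + a₄ = 0 ∧ a₁ ≥ a₂ ∧ a₂ ≥ a₃ ∧ a₃ ≥ a₄ ∧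
        (a₁ > -a₄ ∨ (a₁ = -a₄ ∧ (a₂ > -a₃ ∨ (a₂ = -a₃ ∧
          (a₃ > -a₂ ∨ (a₃ = -a₂ ∧ a₄ ≥ -a₁))))))) ↔
      ∃ c₁ c₂ c₃ c₄ : ℕ,
        a₁ = (c₁ : ℤ) * 1 + (c₂ : ℤ) * 2 + (c₃ : ℤ) * 3 + (c₄ : ℤ) * 1 ∧
        a₂ = (c₁ : ℤ) * 0 + (c₂ : ℤ) * 0 + (c₃ : ℤ) * (-1) + (c₄ : ℤ) * 1 ∧
        a₃ = (c₁ : ℤ) * 0 + (c₂ : ℤ) * (-1) + (c₃ : ℤ) * (-1) + (c₄ : ℤ) * (-1) ∧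
        a₄ = (c₁ : ℤ) * (-1) + (c₂ : ℤ) * (-1) + (c₃ : ℤ) * (-1) + (c₄ : ℤ) * (-1) := by
  constructor
  · intro h
    exact ⟨(a₃ - a₄).toNat, (-a₃ - max a₂ (-a₂)).toNat, (-a₂).toNat, a₂.toNat, by omega⟩
  · rintro ⟨c₁, c₂, c₃, c₄, h₁, h₂, h₃, h₄⟩
    omega
end

section
/- For every n ≥ 2 and m ≥ 1, the invariant field k(X_1, …, X_m)_0^G is generated over k by the element q_{1,…,1} = tr(X_1⋯X_m)·tr((X_1⋯X_m)^{-1}) together with the elements tr(X_h^r)·tr(X_h^{-r}) for h = 1, …, m and r = 1, …, n(n-1)/2. -/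
noncomputable section

open scoped Classical

/-- The rational function field `k(x_{11}, …, x_{mn})` in `m` arrays of `n`
variables each. -/
abbrev RFM (k : Type) [Field k] (m n : ℕ) :=
  FractionRing (MvPolynomial (Fin m × Fin n) k)

/-- The variable `x_{hj}` (the `j`-th entry of the array `X_h`). -/
def xm (k : Type) [Field k] (m n : ℕ) (h : Fin m) (j : Fin n) : RFM k m n :=
  algebraMap (MvPolynomial (Fin m × Fin n) k) (RFM k m n) (MvPolynomial.X (h, j))

/-- The set of ratios `x_{hi}/x_{hj}`, `i ≠ j`, generating `k(X_1, …, X_m)₀`. -/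
def ratioSetM (k : Type) [Field k] (m n : ℕ) : Set (RFM k m n) :=
  {r | ∃ h : Fin m, ∃ i j : Fin n, i ≠ j ∧ r = xm k m n h i / xm k m n h j}

/-- The subgroup of automorphisms generated by the image of `G = S_n × T`, where
`σ ∈ S_n` simultaneously permutes the entries of every array and `τ` inverts all
the variables. -/
def GsubM (k : Type) [Field k] (m n : ℕ) : Subgroup (RFM k m n ≃ₐ[k] RFM k m n) :=
  Subgroup.closure {φ | ∃ σ : Equiv.Perm (Fin n),
    (∀ h j, φ (xm k m n h j) = xm k m n h (σ j)) ∨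
      (∀ h j, φ (xm k m n h j) = (xm k m n h (σ j))⁻¹)}

/-- The invariant field `k(X_1, …, X_m)₀^G`. -/
def InvFM (k : Type) [Field k] (m n : ℕ) : IntermediateField k (RFM k m n) :=
  IntermediateField.adjoin k (ratioSetM k m n) ⊓
    IntermediateField.fixedField (GsubM k m n)

/-- The observable `q_{1,…,1} = tr(X_1⋯X_m) · tr((X_1⋯X_m)⁻¹)`. -/
def q11 (k : Type) [Field k] (m n : ℕ) : RFM k m n :=
  (∑ j, ∏ h, xm k m n h j) * (∑ j, ∏ h, (xm k m n h j)⁻¹)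

/-- The observable `tr(X_h^r) · tr(X_h^{-r})`. -/
def qSingle (k : Type) [Field k] (m n : ℕ) (h : Fin m) (r : ℤ) : RFM k m n :=
  (∑ j, xm k m n h j ^ r) * (∑ j, xm k m n h j ^ (-r))

theorem adjoin_X_fractionRing (k : Type) [Field k] {ι : Type} :
    IntermediateField.adjoin k (Set.range fun i : ι =>
      algebraMap (MvPolynomial ι k) (FractionRing (MvPolynomial ι k)) (MvPolynomial.X i)) = ⊤ := by
  refine eq_top_iff.2 fun z _ => ?_
  have hp (p : MvPolynomial ι k) : algebraMap _ (FractionRing (MvPolynomial ι k)) p ∈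
      IntermediateField.adjoin k (Set.range fun i : ι =>
        algebraMap (MvPolynomial ι k) (FractionRing (MvPolynomial ι k)) (MvPolynomial.X i)) := by
    induction p using MvPolynomial.induction_on with
    | C a =>
      rw [← MvPolynomial.algebraMap_eq, ← IsScalarTower.algebraMap_apply]
      exact IntermediateField.algebraMap_mem _ a
    | add p q hp hq => simpa using add_mem hp hq
    | mul_X p i hp =>
      simpa using mul_mem hp (IntermediateField.subset_adjoin k _ ⟨i, rfl⟩)
  obtain ⟨a, b, _, rfl⟩ := IsFractionRing.div_surjective (A := MvPolynomial ι k) z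
  exact div_mem (hp a) (hp b)

theorem exists_algEquiv_of_adjoin_eq_top (k : Type) [Field k] {ι : Type} [Finite ι]
    (y : ι → FractionRing (MvPolynomial ι k))
    (hy : IntermediateField.adjoin k (Set.range y) = ⊤) :
    ∃ φ : FractionRing (MvPolynomial ι k) ≃ₐ[k] FractionRing (MvPolynomial ι k),
      ∀ i, φ (algebraMap (MvPolynomial ι k) _ (MvPolynomial.X i)) = y i := by
  have halg : Algebra.IsAlgebraic (Algebra.adjoin k (Set.range y))
      (FractionRing (MvPolynomial ι k)) := by
    refine ⟨fun z => ?_⟩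
    have hz : z ∈ IntermediateField.adjoin k (Set.range y) := hy ▸ trivial
    obtain ⟨a, ha, b, hb, rfl⟩ := IntermediateField.mem_adjoin_iff_div.1 hz
    have h1 := isAlgebraic_algebraMap (R := Algebra.adjoin k (Set.range y))
      (A := FractionRing (MvPolynomial ι k)) ⟨a, ha⟩
    have h2 := isAlgebraic_algebraMap (R := Algebra.adjoin k (Set.range y))
      (A := FractionRing (MvPolynomial ι k)) ⟨b, hb⟩
    rw [div_eq_mul_inv]
    exact h1.mul h2.inv
  have htr : Cardinal.mk ι ≤ Algebra.trdeg k (FractionRing (MvPolynomial ι k)) := by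
    have : Algebra.IsAlgebraic (MvPolynomial ι k) (FractionRing (MvPolynomial ι k)) :=
      IsLocalization.isAlgebraic (FractionRing (MvPolynomial ι k)) (nonZeroDivisors (MvPolynomial ι k))
    have := (IsTranscendenceBasis.mvPolynomial ι k).algebraMap_comp
      (A := FractionRing (MvPolynomial ι k))
    exact this.cardinalMk_eq_trdeg.le
  have hind : AlgebraicIndependent k y :=
    (Algebra.IsAlgebraic.isTranscendenceBasis_of_le_trdeg_of_finite k y htr).1
  let f := IsFractionRing.liftAlgHom (K := FractionRing (MvPolynomial ι k))
    (g := MvPolynomial.aeval (R := k) y) hind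
  have hf (i : ι) : f (algebraMap (MvPolynomial ι k) _ (MvPolynomial.X i)) = y i := by
    exact (IsFractionRing.lift_algebraMap (K := FractionRing (MvPolynomial ι k)) hind _).trans
      (MvPolynomial.aeval_X y i)
  refine ⟨AlgEquiv.ofBijective f ⟨f.injective, fun z => ?_⟩, hf⟩
  have : IntermediateField.adjoin k (Set.range y) ≤ f.fieldRange := by
    rw [IntermediateField.adjoin_le_iff]
    rintro _ ⟨i, rfl⟩
    exact ⟨_, hf i⟩
  exact (hy ▸ this) trivial

theorem exists_algEquiv_perm_or_inv (k : Type) [Field k] (m n : ℕ) (σ : Equiv.Perm (Fin n)) :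
    (∃ φ : RFM k m n ≃ₐ[k] RFM k m n, ∀ h j, φ (xm k m n h j) = xm k m n h (σ j)) ∧
    (∃ φ : RFM k m n ≃ₐ[k] RFM k m n, ∀ h j, φ (xm k m n h j) = (xm k m n h (σ j))⁻¹) := by
  constructor
  · obtain ⟨φ, hφ⟩ := exists_algEquiv_of_adjoin_eq_top k
      (fun i : Fin m × Fin n => xm k m n i.1 (σ i.2)) (by
        refine top_le_iff.1 ((adjoin_X_fractionRing k (ι := Fin m × Fin n)).ge.trans ?_)
        rw [IntermediateField.adjoin_le_iff]
        rintro _ ⟨⟨h, j⟩, rfl⟩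
        exact IntermediateField.subset_adjoin k _ ⟨(h, σ.symm j), by simp [xm]⟩)
    exact ⟨φ, fun h j => hφ (h, j)⟩
  · obtain ⟨φ, hφ⟩ := exists_algEquiv_of_adjoin_eq_top k
      (fun i : Fin m × Fin n => (xm k m n i.1 (σ i.2))⁻¹) (by
        refine top_le_iff.1 ((adjoin_X_fractionRing k (ι := Fin m × Fin n)).ge.trans ?_)
        rw [IntermediateField.adjoin_le_iff]
        rintro _ ⟨⟨h, j⟩, rfl⟩
        exact (inv_mem_iff (x := xm k m n h j)).1
          (IntermediateField.subset_adjoin k _ ⟨(h, σ.symm j), by simp⟩))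
    exact ⟨φ, fun h j => hφ (h, j)⟩

theorem aeval_esymm_mem {K L A : Type} [Field K] [Field L] [Algebra K L] [CharZero K] [Fintype A]
    (F : IntermediateField K L) (u : A → L) (N : ℕ)
    (hp : ∀ r, 1 ≤ r → r ≤ N → ∑ a, u a ^ r ∈ F) (r : ℕ) (hr : r ≤ N) :
    MvPolynomial.aeval u (MvPolynomial.esymm A K r) ∈ F := by
  induction r using Nat.strong_induction_on with
  | _ r ih =>
    rcases Nat.eq_zero_or_pos r with rfl | hr0
    · simp
    have hL : CharZero L := charZero_of_injective_algebraMap (algebraMap K L).injective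
    have h := congrArg (MvPolynomial.aeval u) (MvPolynomial.mul_esymm_eq_sum A K r)
    simp only [map_mul, map_natCast, map_pow, map_neg, map_one, map_sum] at h
    have hr' : (r : L) ≠ 0 := Nat.cast_ne_zero.2 hr0.ne'
    rw [← mul_div_cancel_left₀ (MvPolynomial.aeval u (MvPolynomial.esymm A K r)) hr', h]
    have hneg (s : ℕ) : (-1 : L) ^ s ∈ F := pow_mem (neg_mem (one_mem F)) s
    refine div_mem (mul_mem (hneg _) (sum_mem fun a ha => ?_)) (natCast_mem F r)
    simp only [Finset.mem_filter, Finset.HasAntidiagonal.mem_antidiagonal] at ha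
    refine mul_mem (mul_mem (hneg _) (ih _ ha.2 (by omega))) ?_
    simpa [MvPolynomial.psum] using hp a.2 (by omega) (by omega)

theorem reverse_prod_X_sub_C {L A : Type} [Field L] (s : Finset A) (u : A → L) :
    (∏ a ∈ s, (Polynomial.X - Polynomial.C (u a))).reverse =
      ∏ a ∈ s, (1 - Polynomial.C (u a) * Polynomial.X) := by
  induction s using Finset.induction_on with
  | empty => simp [← Polynomial.C_1, -map_one]
  | insert a s ha ih =>
    have h : (Polynomial.X - Polynomial.C (u a)).reverse =
        1 - Polynomial.C (u a) * Polynomial.X := by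
      rw [sub_eq_add_neg, ← map_neg, Polynomial.reverse_add_C]
      have hX : (Polynomial.X : Polynomial L).reverse = 1 := by
        simpa [← Polynomial.C_1, -map_one] using Polynomial.reverse_mul_X (1 : Polynomial L)
      simp [hX, sub_eq_add_neg]
    rw [Finset.prod_insert ha, Finset.prod_insert ha, Polynomial.reverse_mul_of_domain, ih, h]

theorem prod_X_sub_C_coeff_mem {K L A : Type} [Field K] [Field L] [Algebra K L] [CharZero K]
    [Fintype A] (F : IntermediateField K L) (u : A → L) (ι : Equiv.Perm A) (N : ℕ)
    (hcard : Fintype.card A = 2 * N) (hu : ∀ a, u a ≠ 0) (hι : ∀ a, u (ι a) = (u a)⁻¹)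
    (hp : ∀ r, 1 ≤ r → r ≤ N → ∑ a, u a ^ r ∈ F) (i : ℕ) :
    (∏ a, (Polynomial.X - Polynomial.C (u a))).coeff i ∈ F := by
  set P := ∏ a, (Polynomial.X - Polynomial.C (u a)) with hP
  have hdeg : P.natDegree = 2 * N := by
    rw [hP, Polynomial.natDegree_finsetProd_X_sub_C_eq_card, Finset.card_univ, hcard]
  have hhigh (i : ℕ) (hi : N ≤ i) (hi' : i ≤ 2 * N) : P.coeff i ∈ F := by
    have h := Multiset.prod_X_sub_C_coeff (Finset.univ.val.map u) (k := i)
      (by simpa [hcard] using hi')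
    rw [Multiset.map_map, Multiset.card_map, Finset.card_val, Finset.card_univ, hcard,
      ← MvPolynomial.aeval_esymm_eq_multiset_esymm A K] at h
    have hP' : P = (Finset.univ.val.map
      ((fun t => Polynomial.X - Polynomial.C t) ∘ u)).prod := rfl
    rw [hP', h]
    exact mul_mem (pow_mem (neg_mem (one_mem F)) _) (aeval_esymm_mem F u N hp _ (by omega))
  have hone : (∏ a, u a) ^ 2 = 1 := by
    have : ∏ a, u a = (∏ a, u a)⁻¹ := by
      conv_lhs => rw [← Equiv.prod_comp ι]
      simp [hι]
    rw [sq]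
    nth_rw 1 [this]
    exact inv_mul_cancel₀ (Finset.prod_ne_zero_iff.2 fun a _ => hu a)
  have hone' : ∏ a, u a ∈ F := by
    rcases mul_self_eq_one_iff.1 ((sq _).symm.trans hone) with h | h <;> rw [h]
    · exact one_mem F
    · exact neg_mem (one_mem F)
  have hrev : P.reverse = Polynomial.C (∏ a, u a) * P := by
    have hP' : P = ∏ a, (Polynomial.C (u (ι a)) - Polynomial.X) * (-1) := by
      rw [hP, ← Equiv.prod_comp ι]
      exact Finset.prod_congr rfl fun a _ => by ring
    rw [hP, reverse_prod_X_sub_C, ← hP, hP', Finset.prod_mul_distrib, Finset.prod_const,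
      Finset.card_univ, hcard, pow_mul, neg_one_sq, one_pow, mul_one, map_prod,
      ← Finset.prod_mul_distrib]
    refine Finset.prod_congr rfl fun a _ => ?_
    rw [mul_sub, ← map_mul, hι, mul_inv_cancel₀ (hu a), map_one]
  rcases lt_or_ge (2 * N) i with h | h
  · rw [Polynomial.coeff_eq_zero_of_natDegree_lt (hdeg ▸ h)]
    exact zero_mem F
  rcases le_total N i with h' | h'
  · exact hhigh i h' h
  · have := Polynomial.coeff_reverse P (2 * N - i)
    rw [hrev, Polynomial.coeff_C_mul, hdeg, Polynomial.revAt_le (by omega),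
      show 2 * N - (2 * N - i) = i by omega] at this
    rw [← this]
    exact mul_mem hone' (hhigh _ (by omega) (by omega))

theorem xm_ne_zero (k : Type) [Field k] (m n : ℕ) (h : Fin m) (j : Fin n) :
    xm k m n h j ≠ 0 := by
  simp [xm]

theorem exists_eq_of_sum_prod_ratio_eq (k : Type) [Field k] [CharZero k] (m n : ℕ) {A : Type}
    [Fintype A] (p q p' q' : A → Fin m → Fin n)
    (hpq : ∀ a h, p a h ≠ q a h) (hpq' : ∀ a h, p' a h ≠ q' a h)
    (heq : ∑ a, ∏ h, xm k m n h (p a h) / xm k m n h (q a h) =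
      ∑ a, ∏ h, xm k m n h (p' a h) / xm k m n h (q' a h)) (a : A) :
    ∃ b, p a = p' b ∧ q a = q' b := by
  let d (p q : Fin m → Fin n) : Fin m × Fin n →₀ ℕ :=
    ∑ h, (Finsupp.single (h, p h) 1 + ∑ j ∈ Finset.univ.erase (q h), Finsupp.single (h, j) 1)
  have hd (p q : Fin m → Fin n) (h : Fin m) (j : Fin n) :
      d p q (h, j) = (if p h = j then 1 else 0) + if j = q h then 0 else 1 := by
    simp only [d, Finsupp.coe_finsetSum, Finset.sum_apply, Finsupp.add_apply,
      Finsupp.single_apply, Prod.mk.injEq]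
    rw [Finset.sum_eq_single h]
    · simp [Finset.sum_ite_eq, eq_comm]
    · intro b _ hb
      simp [hb]
    · simp
  have hmon (p q : Fin m → Fin n) :
      (∏ h, xm k m n h (p h) / xm k m n h (q h)) * ∏ h, ∏ j, xm k m n h j =
        algebraMap (MvPolynomial (Fin m × Fin n) k) _ (MvPolynomial.monomial (d p q) 1) := by
    rw [MvPolynomial.monomial_sum_one, map_prod, ← Finset.prod_mul_distrib]
    refine Finset.prod_congr rfl fun h _ => ?_
    rw [← Finset.mul_prod_erase _ _ (Finset.mem_univ (q h)), ← mul_assoc,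
      div_mul_cancel₀ _ (xm_ne_zero k m n h _), ← one_mul (1 : k), ← MvPolynomial.monomial_mul,
      MvPolynomial.monomial_sum_one, map_mul, map_prod]
    rfl
  have hinj (p q p' q' : Fin m → Fin n) (hpq : ∀ h, p h ≠ q h) (hpq' : ∀ h, p' h ≠ q' h)
      (h : d p q = d p' q') : p = p' ∧ q = q' := by
    refine ⟨funext fun i => ?_, funext fun i => ?_⟩
    · have h1 := DFunLike.congr_fun h (i, p i)
      rw [hd, hd] at h1
      have := hpq i
      grind
    · have h1 := DFunLike.congr_fun h (i, q i)
      rw [hd, hd] at h1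
      have := hpq i
      grind
  have hpoly : ∑ a, MvPolynomial.monomial (d (p a) (q a)) (1 : k) =
      ∑ a, MvPolynomial.monomial (d (p' a) (q' a)) (1 : k) := by
    apply IsFractionRing.injective (MvPolynomial (Fin m × Fin n) k) (RFM k m n)
    simp only [map_sum, ← hmon]
    rw [← Finset.sum_mul, heq, Finset.sum_mul]
  have hc := congrArg (MvPolynomial.coeff (d (p a) (q a))) hpoly
  simp only [MvPolynomial.coeff_sum, MvPolynomial.coeff_monomial, Finset.sum_boole] at hc
  have hc' := Nat.cast_injective hc
  have hpos : 0 < (Finset.univ.filter fun b => d (p b) (q b) = d (p a) (q a)).card :=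
    Finset.card_pos.2 ⟨a, by simp⟩
  rw [hc'] at hpos
  obtain ⟨b, hb⟩ := Finset.card_pos.1 hpos
  exact ⟨b, hinj _ _ _ _ (hpq a) (hpq' b) (Finset.mem_filter.1 hb).2.symm⟩

theorem indices_eq_of_mul_eq (k : Type) [Field k] (m n : ℕ) (h : Fin m) (a b c d e f : Fin n)
    (hab : a ≠ b) (hcd : c ≠ d) (hef : e ≠ f)
    (heq : xm k m n h a / xm k m n h b =
      xm k m n h c / xm k m n h d * (xm k m n h e / xm k m n h f)) :
    (a = c ∧ d = e ∧ f = b) ∨ (a = e ∧ f = c ∧ d = b) := by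
  have h0 := xm_ne_zero k m n h
  have h1 : xm k m n h a * xm k m n h d * xm k m n h f =
      xm k m n h c * xm k m n h e * xm k m n h b := by
    have := h0 b
    have := h0 d
    have := h0 f
    field_simp at heq
    linear_combination heq
  simp only [xm, ← map_mul] at h1
  have h2 := IsFractionRing.injective (MvPolynomial (Fin m × Fin n) k) (RFM k m n) h1
  simp only [MvPolynomial.X, MvPolynomial.monomial_mul, one_mul] at h2
  have h3 := MvPolynomial.monomial_left_injective (one_ne_zero) h2
  have h4 (z : Fin n) := DFunLike.congr_fun h3 (h, z)
  simp only [Finsupp.add_apply, Finsupp.single_apply, Prod.mk.injEq, true_and] at h4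
  have ha := h4 a
  have hb := h4 b
  have hd := h4 d
  have hf := h4 f
  grind

theorem indices_eq_of_eq_inv (k : Type) [Field k] (m n : ℕ) (h : Fin m) (a b c d : Fin n)
    (hab : a ≠ b) (heq : xm k m n h a / xm k m n h b = (xm k m n h c / xm k m n h d)⁻¹) :
    a = d ∧ b = c := by
  have h0 := xm_ne_zero k m n h
  have h1 : xm k m n h a * xm k m n h c = xm k m n h b * xm k m n h d := by
    have := h0 b
    have := h0 c
    have := h0 d
    field_simp at heq
    linear_combination heq
  simp only [xm, ← map_mul] at h1
  have h2 := IsFractionRing.injective (MvPolynomial (Fin m × Fin n) k) (RFM k m n) h1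
  simp only [MvPolynomial.X, MvPolynomial.monomial_mul, one_mul] at h2
  have h3 := MvPolynomial.monomial_left_injective (one_ne_zero) h2
  have h4 (z : Fin n) := DFunLike.congr_fun h3 (h, z)
  simp only [Finsupp.add_apply, Finsupp.single_apply, Prod.mk.injEq, true_and] at h4
  have ha := h4 a
  have hb := h4 b
  grind

theorem exists_perm_of_root_relations_of_fst {n : ℕ} (f₁ f₂ : Fin n → Fin n → Fin n)
    (hne : ∀ i j, i ≠ j → f₁ i j ≠ f₂ i j)
    (hinv : ∀ i j, i ≠ j → f₁ j i = f₂ i j ∧ f₂ j i = f₁ i j)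
    (hmul : ∀ i j k, i ≠ j → i ≠ k → k ≠ j →
      (f₁ i j = f₁ i k ∧ f₂ i k = f₁ k j ∧ f₂ k j = f₂ i j) ∨
        (f₁ i j = f₁ k j ∧ f₂ k j = f₁ i k ∧ f₂ i k = f₂ i j))
    (i₀ a : Fin n) (ha : ∀ j, i₀ ≠ j → f₁ i₀ j = a) :
    ∃ σ : Equiv.Perm (Fin n), ∀ i j, i ≠ j → f₁ i j = σ i ∧ f₂ i j = σ j := by
  let s : Fin n → Fin n := fun j => if j = i₀ then a else f₂ i₀ j
  have hs : ∀ i j, i ≠ j → f₁ i j = s i ∧ f₂ i j = s j := by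
    intro i j hij
    by_cases hi : i = i₀
    · subst hi
      have := ha j hij
      grind
    · by_cases hj : j = i₀
      · subst hj
        have := ha i (Ne.symm hi)
        have := hinv j i hij.symm
        grind
      · have h1 := ha i (Ne.symm hi)
        have h2 := ha j (Ne.symm hj)
        have h3 := hmul i₀ j i (Ne.symm hj) (Ne.symm hi) hij
        have h4 := hne i j hij
        grind
  have hinj : Function.Injective s := by
    intro i j h
    by_contra hij
    have := hs i j hij
    exact hne i j hij (by rw [this.1, this.2, h])
  exact ⟨Equiv.ofBijective s (Finite.injective_iff_bijective.1 hinj), hs⟩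

theorem exists_perm_of_root_relations {n : ℕ} (i₀ : Fin n) (f₁ f₂ : Fin n → Fin n → Fin n)
    (hne : ∀ i j, i ≠ j → f₁ i j ≠ f₂ i j)
    (hinv : ∀ i j, i ≠ j → f₁ j i = f₂ i j ∧ f₂ j i = f₁ i j)
    (hmul : ∀ i j k, i ≠ j → i ≠ k → k ≠ j →
      (f₁ i j = f₁ i k ∧ f₂ i k = f₁ k j ∧ f₂ k j = f₂ i j) ∨
        (f₁ i j = f₁ k j ∧ f₂ k j = f₁ i k ∧ f₂ i k = f₂ i j)) :
    ∃ σ : Equiv.Perm (Fin n), (∀ i j, i ≠ j → f₁ i j = σ i ∧ f₂ i j = σ j) ∨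
      (∀ i j, i ≠ j → f₂ i j = σ i ∧ f₁ i j = σ j) := by
  have hd : (∃ a, ∀ j, i₀ ≠ j → f₁ i₀ j = a) ∨ (∃ a, ∀ j, i₀ ≠ j → f₂ i₀ j = a) := by
    by_cases hex : ∃ j, i₀ ≠ j
    · obtain ⟨j, hj⟩ := hex
      by_contra! h
      obtain ⟨⟨k, hk, hk'⟩, ⟨l, hl, hl'⟩⟩ := And.imp (· (f₁ i₀ j)) (· (f₂ i₀ j)) h
      have h1 := hmul i₀ j k hj hk (by grind)
      have h2 := hmul i₀ j l hj hl (by grind)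
      have h3 := hmul i₀ k l hk hl
      have h4 := hne k j (by grind)
      have h5 := hne l j (by grind)
      have h6 := hne l k
      grind
    · push Not at hex
      exact .inl ⟨i₀, fun j hj => absurd (hex j) hj⟩
  rcases hd with ⟨a, ha⟩ | ⟨a, ha⟩
  · obtain ⟨σ, hσ⟩ := exists_perm_of_root_relations_of_fst f₁ f₂ hne hinv hmul i₀ a ha
    exact ⟨σ, .inl hσ⟩
  · obtain ⟨σ, hσ⟩ := exists_perm_of_root_relations_of_fst f₂ f₁
      (fun i j h => (hne i j h).symm) (fun i j h => (hinv i j h).symm)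
      (fun i j k h h' h'' => by have := hmul i j k h h' h''; grind) i₀ a ha
    exact ⟨σ, .inr hσ⟩

theorem sum_sum_eq_add_sum_offDiag {L : Type} [Field L] {n : ℕ} (g : Fin n → Fin n → L)
    (hg : ∀ i, g i i = 1) :
    ∑ i, ∑ j, g i j = n + ∑ a : {p : Fin n × Fin n // p.1 ≠ p.2}, g a.1.1 a.1.2 := by
  rw [← Fintype.sum_prod_type' g,
    ← Fintype.sum_subtype_add_sum_subtype (fun p : Fin n × Fin n => p.1 ≠ p.2), add_comm]
  congr 1
  let e : Fin n ≃ {p : Fin n × Fin n // ¬ p.1 ≠ p.2} :=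
    ⟨fun i => ⟨(i, i), by simp⟩, fun p => p.1.1, fun _ => rfl,
      fun ⟨⟨i, j⟩, h⟩ => by simpa using h⟩
  rw [← Equiv.sum_comp e]
  simp [e, hg]

theorem q11_eq_sum (k : Type) [Field k] (m n : ℕ) :
    q11 k m n = ∑ i, ∑ j, ∏ h, xm k m n h i / xm k m n h j := by
  simp [q11, Finset.sum_mul_sum, div_eq_mul_inv, Finset.prod_mul_distrib]

theorem qSingle_eq_sum (k : Type) [Field k] (m n : ℕ) (h : Fin m) (r : ℕ) :
    qSingle k m n h r = ∑ i, ∑ j, (xm k m n h i / xm k m n h j) ^ r := by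
  simp [qSingle, Finset.sum_mul_sum, div_eq_mul_inv, mul_pow]

theorem ratio_mem_adjoin (k : Type) [Field k] (m n : ℕ) (h : Fin m) (i j : Fin n) :
    xm k m n h i / xm k m n h j ∈ IntermediateField.adjoin k (ratioSetM k m n) := by
  by_cases hij : i = j
  · rw [hij, div_self (xm_ne_zero k m n h j)]
    exact one_mem _
  · exact IntermediateField.subset_adjoin k _ ⟨h, i, j, hij, rfl⟩

theorem mem_fixedField_GsubM (k : Type) [Field k] (m n : ℕ) {z : RFM k m n}
    (hz : ∀ (φ : RFM k m n ≃ₐ[k] RFM k m n) (σ : Equiv.Perm (Fin n)),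
      ((∀ h j, φ (xm k m n h j) = xm k m n h (σ j)) ∨
        (∀ h j, φ (xm k m n h j) = (xm k m n h (σ j))⁻¹)) → φ z = z) :
    z ∈ IntermediateField.fixedField (GsubM k m n) := by
  rw [IntermediateField.mem_fixedField_iff]
  have : GsubM k m n ≤ MulAction.stabilizer _ z := by
    rw [GsubM, Subgroup.closure_le]
    rintro φ ⟨σ, hφ⟩
    exact hz φ σ hφ
  exact fun φ hφ => this hφ

theorem q11_mem_InvFM (k : Type) [Field k] (m n : ℕ) : q11 k m n ∈ InvFM k m n := by
  refine ⟨?_, mem_fixedField_GsubM k m n ?_⟩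
  · rw [q11_eq_sum]
    exact sum_mem fun i _ => sum_mem fun j _ => prod_mem fun h _ => ratio_mem_adjoin k m n h i j
  · rintro φ σ (hφ | hφ)
    · simp only [q11, map_mul, map_sum, map_prod, map_inv₀, hφ]
      rw [Equiv.sum_comp σ fun j => ∏ h, xm k m n h j,
        Equiv.sum_comp σ fun j => ∏ h, (xm k m n h j)⁻¹]
    · simp only [q11, map_mul, map_sum, map_prod, map_inv₀, hφ, inv_inv]
      rw [Equiv.sum_comp σ fun j => ∏ h, xm k m n h j,
        Equiv.sum_comp σ fun j => ∏ h, (xm k m n h j)⁻¹, mul_comm]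

theorem qSingle_mem_InvFM (k : Type) [Field k] (m n : ℕ) (h : Fin m) (r : ℕ) :
    qSingle k m n h r ∈ InvFM k m n := by
  refine ⟨?_, mem_fixedField_GsubM k m n ?_⟩
  · rw [qSingle_eq_sum]
    exact sum_mem fun i _ => sum_mem fun j _ => pow_mem (ratio_mem_adjoin k m n h i j) r
  · rintro φ σ (hφ | hφ)
    · simp only [qSingle, map_mul, map_sum, map_zpow₀, hφ]
      rw [Equiv.sum_comp σ fun j => xm k m n h j ^ (r : ℤ),
        Equiv.sum_comp σ fun j => xm k m n h j ^ (-r : ℤ)]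
    · simp only [qSingle, map_mul, map_sum, map_zpow₀, hφ, inv_zpow', neg_neg]
      rw [Equiv.sum_comp σ fun j => xm k m n h j ^ (r : ℤ),
        Equiv.sum_comp σ fun j => xm k m n h j ^ (-r : ℤ), mul_comm]

theorem prod_X_sub_C_ratio_coeff_mem (k : Type) [Field k] [CharZero k] (m n : ℕ)
    (F : IntermediateField k (RFM k m n)) (h : Fin m)
    (hF : ∀ r : ℕ, 1 ≤ r → r ≤ n * (n - 1) / 2 → qSingle k m n h r ∈ F) (i : ℕ) :
    (∏ a : {p : Fin n × Fin n // p.1 ≠ p.2}, (Polynomial.X -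
      Polynomial.C (xm k m n h a.1.1 / xm k m n h a.1.2))).coeff i ∈ F := by
  let ι : Equiv.Perm {p : Fin n × Fin n // p.1 ≠ p.2} :=
    (Equiv.prodComm _ _).subtypeEquiv fun p => ne_comm
  refine prod_X_sub_C_coeff_mem F (fun a : {p : Fin n × Fin n // p.1 ≠ p.2} =>
    xm k m n h a.1.1 / xm k m n h a.1.2) ι (n * (n - 1) / 2) ?_ ?_ ?_ ?_ i
  · rw [Nat.mul_div_cancel' (even_iff_two_dvd.1 (Nat.even_mul_pred_self n)),
      Fintype.card_subtype, Nat.mul_sub_one]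
    have := Finset.offDiag_card (Finset.univ : Finset (Fin n))
    rw [Finset.card_univ, Fintype.card_fin] at this
    rw [← this]
    congr 1
    ext p
    simp
  · exact fun a => div_ne_zero (xm_ne_zero k m n _ _) (xm_ne_zero k m n _ _)
  · intro a
    rw [inv_div]
    rfl
  · intro r hr hr'
    have h1 := hF r hr hr'
    rw [qSingle_eq_sum, sum_sum_eq_add_sum_offDiag _
      fun i => by rw [div_self (xm_ne_zero k m n h i), one_pow]] at h1
    simpa using sub_mem h1 (natCast_mem F n)

theorem exists_perm_of_algEquiv (k : Type) [Field k] [CharZero k] (m n : ℕ) (h₀ : Fin m)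
    (i₀ : Fin n) {R : Type} [Field R] [Algebra R (RFM k m n)]
    (E : IntermediateField R (RFM k m n)) (φ : E →ₐ[R] RFM k m n)
    (hE : ∀ h i j, xm k m n h i / xm k m n h j ∈ E)
    (hroot : ∀ h i j, i ≠ j → ∃ a b, a ≠ b ∧
      φ ⟨_, hE h i j⟩ = xm k m n h a / xm k m n h b)
    (hq : q11 k m n ∈ Set.range (algebraMap R (RFM k m n))) :
    ∃ σ : Equiv.Perm (Fin n),
      (∀ h i j, i ≠ j → φ ⟨_, hE h i j⟩ = xm k m n h (σ i) / xm k m n h (σ j)) ∨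
      (∀ h i j, i ≠ j → φ ⟨_, hE h i j⟩ = xm k m n h (σ j) / xm k m n h (σ i)) := by
  choose! f g hfg hφ using hroot
  have hconst (i j : Fin n) (hij : i ≠ j) : ∃ c d, ∀ h, f h i j = c ∧ g h i j = d := by
    have hsum : (∑ a : {p : Fin n × Fin n // p.1 ≠ p.2},
          ∏ h, xm k m n h (f h a.1.1 a.1.2) / xm k m n h (g h a.1.1 a.1.2)) =
        ∑ a : {p : Fin n × Fin n // p.1 ≠ p.2}, ∏ h, xm k m n h a.1.1 / xm k m n h a.1.2 := by
      obtain ⟨c, hc⟩ := hq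
      rw [q11_eq_sum, sum_sum_eq_add_sum_offDiag _
        fun i => Finset.prod_eq_one fun h _ => div_self (xm_ne_zero k m n h i)] at hc
      have hc' : (∑ a : {p : Fin n × Fin n // p.1 ≠ p.2},
          ∏ h, (⟨_, hE h a.1.1 a.1.2⟩ : E)) = algebraMap R E c - n := by
        apply Subtype.val_injective
        simp only [IntermediateField.coe_sum, IntermediateField.coe_prod]
        push_cast
        exact (eq_sub_of_add_eq' hc.symm)
      have := congrArg φ hc'
      simp only [map_sum, map_prod, map_sub, map_natCast, AlgHom.commutes, hc,
        add_sub_cancel_left] at this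
      rw [← this]
      exact Finset.sum_congr rfl fun a _ => Finset.prod_congr rfl fun h _ => (hφ h _ _ a.2).symm
    obtain ⟨b, hb, hb'⟩ := exists_eq_of_sum_prod_ratio_eq k m n
      (A := {p : Fin n × Fin n // p.1 ≠ p.2})
      (fun a h => f h a.1.1 a.1.2) (fun a h => g h a.1.1 a.1.2)
      (fun a _ => a.1.1) (fun a _ => a.1.2)
      (fun a h => hfg h _ _ a.2) (fun a _ => a.2) hsum ⟨(i, j), hij⟩
    exact ⟨b.1.1, b.1.2, fun h => ⟨congrFun hb h, congrFun hb' h⟩⟩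
  have hmul (i j l : Fin n) : φ ⟨_, hE h₀ i j⟩ = φ ⟨_, hE h₀ i l⟩ * φ ⟨_, hE h₀ l j⟩ := by
    rw [← map_mul]
    congr 1
    exact Subtype.ext (div_mul_div_cancel₀ (xm_ne_zero k m n h₀ l)).symm
  have hinv (i j : Fin n) : φ ⟨_, hE h₀ j i⟩ = (φ ⟨_, hE h₀ i j⟩)⁻¹ := by
    rw [← map_inv₀]
    congr 1
    exact Subtype.ext (inv_div _ _).symm
  obtain ⟨σ, hσ⟩ := exists_perm_of_root_relations i₀ (f h₀) (g h₀) (hfg h₀)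
    (fun i j hij => by
      have h1 := hinv i j
      rw [hφ h₀ _ _ hij, hφ h₀ _ _ hij.symm] at h1
      exact indices_eq_of_eq_inv k m n h₀ _ _ _ _ (hfg h₀ _ _ hij.symm) h1)
    (fun i j l hij hil hlj => by
      have h1 := hmul i j l
      rw [hφ h₀ _ _ hij, hφ h₀ _ _ hil, hφ h₀ _ _ hlj] at h1
      exact indices_eq_of_mul_eq k m n h₀ _ _ _ _ _ _ (hfg h₀ _ _ hij) (hfg h₀ _ _ hil)
        (hfg h₀ _ _ hlj) h1)
  refine ⟨σ, hσ.imp (fun hσ h i j hij => ?_) fun hσ h i j hij => ?_⟩ <;>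
  · obtain ⟨c, d, hcd⟩ := hconst i j hij
    rw [hφ h i j hij, (hcd h).1, (hcd h).2, ← (hcd h₀).1, ← (hcd h₀).2, (hσ i j hij).1,
      (hσ i j hij).2]

theorem isGalois_adjoin_ratioSetM (k : Type) [Field k] [CharZero k] (m n : ℕ)
    (F : IntermediateField k (RFM k m n))
    (Q : Fin m → Polynomial F)
    (hQ : ∀ h, (Q h).map (algebraMap F (RFM k m n)) =
      ∏ a : {p : Fin n × Fin n // p.1 ≠ p.2}, (Polynomial.X -
        Polynomial.C (xm k m n h a.1.1 / xm k m n h a.1.2))) :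
    IsGalois F (IntermediateField.adjoin F (ratioSetM k m n)) := by
  have hmap : (∏ h, Q h).map (algebraMap F (RFM k m n)) =
      ∏ h, ∏ a : {p : Fin n × Fin n // p.1 ≠ p.2}, (Polynomial.X -
        Polynomial.C (xm k m n h a.1.1 / xm k m n h a.1.2)) := by
    rw [Polynomial.map_prod]
    exact Finset.prod_congr rfl fun h _ => hQ h
  have hsplit : ((∏ h, Q h).map (algebraMap F (RFM k m n))).Splits := by
    rw [hmap]
    exact Polynomial.Splits.prod fun h _ => Polynomial.Splits.prod fun a _ =>
      Polynomial.Splits.X_sub_C _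
  have hne : (∏ h, Q h).map (algebraMap F (RFM k m n)) ≠ 0 := by
    rw [hmap]
    exact Finset.prod_ne_zero_iff.2 fun h _ => Finset.prod_ne_zero_iff.2 fun a _ =>
      Polynomial.X_sub_C_ne_zero _
  have hset : (∏ h, Q h).rootSet (RFM k m n) = ratioSetM k m n := by
    ext z
    rw [Polynomial.mem_rootSet', ← Polynomial.eval_map_algebraMap, hmap]
    rw [hmap] at hne
    simp only [ne_eq, hne, not_false_eq_true, true_and, Polynomial.eval_prod,
      Finset.prod_eq_zero_iff, Polynomial.eval_sub, Polynomial.eval_X, Polynomial.eval_C,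
      sub_eq_zero, Finset.mem_univ, Subtype.exists, Prod.exists, ratioSetM, Set.mem_ofPred_eq,
      exists_prop]
  have := IntermediateField.adjoin_rootSet_isSplittingField hsplit
  rw [hset] at this
  have : Normal F (IntermediateField.adjoin F (ratioSetM k m n)) :=
    Normal.of_isSplittingField (∏ h, Q h)
  have : Algebra.IsAlgebraic F (IntermediateField.adjoin F (ratioSetM k m n)) :=
    Normal.toIsAlgebraic
  have : CharZero F := charZero_of_injective_algebraMap (algebraMap k F).injective
  have : PerfectField F := PerfectField.ofCharZero
  have : Algebra.IsSeparable F (IntermediateField.adjoin F (ratioSetM k m n)) :=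
    Algebra.IsAlgebraic.isSeparable_of_perfectField
  exact ⟨⟩

theorem InvFM_le (k : Type) [Field k] [CharZero k] (m n : ℕ) (h₀ : Fin m) (i₀ : Fin n)
    (F : IntermediateField k (RFM k m n)) (hFI : F ≤ InvFM k m n) (hq : q11 k m n ∈ F)
    (hF : ∀ h, ∀ r : ℕ, 1 ≤ r → r ≤ n * (n - 1) / 2 → qSingle k m n h r ∈ F) :
    InvFM k m n ≤ F := by
  have hlift (h : Fin m) : ∃ Q : Polynomial F, Q.map (algebraMap F (RFM k m n)) =
      ∏ a : {p : Fin n × Fin n // p.1 ≠ p.2}, (Polynomial.X -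
        Polynomial.C (xm k m n h a.1.1 / xm k m n h a.1.2)) := by
    rw [← Polynomial.mem_lifts, Polynomial.lifts_iff_coeff_lifts]
    exact fun i => ⟨⟨_, prod_X_sub_C_ratio_coeff_mem k m n F h (hF h) i⟩, rfl⟩
  choose Q hQ using hlift
  have hGal := isGalois_adjoin_ratioSetM k m n F Q hQ
  set E := IntermediateField.adjoin F (ratioSetM k m n) with hEdef
  have hle : IntermediateField.adjoin k (ratioSetM k m n) ≤ E.restrictScalars k := by
    rw [IntermediateField.adjoin_le_iff]
    exact IntermediateField.subset_adjoin F _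
  have hE (h i j) : xm k m n h i / xm k m n h j ∈ E := hle (ratio_mem_adjoin k m n h i j)
  intro z hz
  have hfix : ∀ φ : E ≃ₐ[F] E, φ ⟨z, hle hz.1⟩ = ⟨z, hle hz.1⟩ := by
    intro φ
    obtain ⟨σ, hσ⟩ := exists_perm_of_algEquiv k m n h₀ i₀ E (E.val.comp φ.toAlgHom) hE
      (fun h i j hij => by
        set ψ := E.val.comp φ.toAlgHom
        have h1 : Polynomial.aeval (xm k m n h i / xm k m n h j) (Q h) = 0 := by
          rw [← Polynomial.eval_map_algebraMap, hQ, Polynomial.eval_prod]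
          exact Finset.prod_eq_zero (Finset.mem_univ ⟨(i, j), hij⟩) (by simp)
        have h2 : Polynomial.aeval (⟨_, hE h i j⟩ : E) (Q h) = 0 := by
          apply Subtype.val_injective
          have := Polynomial.aeval_algHom_apply E.val (⟨_, hE h i j⟩ : E) (Q h)
          exact this.symm.trans h1
        have h3 : Polynomial.aeval (ψ ⟨_, hE h i j⟩) (Q h) = 0 := by
          rw [Polynomial.aeval_algHom_apply, h2, map_zero]
        rw [← Polynomial.eval_map_algebraMap, hQ, Polynomial.eval_prod,
          Finset.prod_eq_zero_iff] at h3
        obtain ⟨a, _, ha⟩ := h3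
        exact ⟨a.1.1, a.1.2, a.2, by simpa [sub_eq_zero] using ha⟩)
      ⟨⟨_, hq⟩, rfl⟩
    have hg : ∃ g ∈ GsubM k m n, ∀ h i j, i ≠ j →
        (φ ⟨_, hE h i j⟩ : RFM k m n) = g (xm k m n h i / xm k m n h j) := by
      obtain ⟨⟨g, hg⟩, ⟨g', hg'⟩⟩ := exists_algEquiv_perm_or_inv k m n σ
      rcases hσ with hσ | hσ
      · refine ⟨g, Subgroup.subset_closure ⟨σ, .inl hg⟩, fun h i j hij => ?_⟩
        rw [map_div₀, hg, hg]
        exact hσ h i j hij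
      · refine ⟨g', Subgroup.subset_closure ⟨σ, .inr hg'⟩, fun h i j hij => ?_⟩
        rw [map_div₀, hg', hg', inv_div_inv]
        exact hσ h i j hij
    obtain ⟨g, hgG, hg⟩ := hg
    have hfixed {y : RFM k m n} (hy : y ∈ InvFM k m n) : g y = y :=
      (IntermediateField.mem_fixedField_iff _ _).1 hy.2 g hgG
    let g' : RFM k m n →ₐ[F] RFM k m n :=
      { (g : RFM k m n →+* RFM k m n) with commutes' := fun y => hfixed (hFI y.2) }
    have heq : E.val.comp φ.toAlgHom = g'.comp E.val := by
      refine IntermediateField.algHom_ext_of_eq_adjoin F hEdef ?_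
      rintro _ ⟨h, i, j, hij, rfl⟩
      exact hg h i j hij
    apply Subtype.val_injective
    exact (DFunLike.congr_fun heq ⟨z, hle hz.1⟩).trans (hfixed hz)
  obtain ⟨y, hy⟩ := IntermediateField.mem_bot.1 ((InfiniteGalois.mem_bot_iff_fixed _).2 hfix)
  have hyz : (y : RFM k m n) = z := congrArg Subtype.val hy
  exact hyz ▸ y.2

/-- `k(X_1,…,X_m)₀^G` is generated over `k` by `q_{1,…,1}` together with the
observables `tr(X_h^r)·tr(X_h^{-r})`, `h = 1,…,m`, `r = 1,…,n(n-1)/2`. -/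
theorem stmt14 (k : Type) [Field k] [CharZero k] (m n : ℕ)
    (hm : 1 ≤ m) (hn : 2 ≤ n) :
    InvFM k m n =
      IntermediateField.adjoin k
        ({q11 k m n} ∪
          {v | ∃ h : Fin m, ∃ r : ℕ, 1 ≤ r ∧ r ≤ n * (n - 1) / 2 ∧
            v = qSingle k m n h (r : ℤ)}) := by
  have hle : IntermediateField.adjoin k
        ({q11 k m n} ∪
          {v | ∃ h : Fin m, ∃ r : ℕ, 1 ≤ r ∧ r ≤ n * (n - 1) / 2 ∧
            v = qSingle k m n h (r : ℤ)}) ≤ InvFM k m n := by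
    rw [IntermediateField.adjoin_le_iff]
    rintro _ (rfl | ⟨h, r, _, _, rfl⟩)
    · exact q11_mem_InvFM k m n
    · exact qSingle_mem_InvFM k m n h r
  refine le_antisymm (InvFM_le k m n ⟨0, hm⟩ ⟨0, by omega⟩ _ hle ?_ ?_) hle
  · exact IntermediateField.subset_adjoin k _ (.inl rfl)
  · exact fun h r hr hr' => IntermediateField.subset_adjoin k _ (.inr ⟨h, r, hr, hr', rfl⟩)
end
end

section
/- Assume n ≥ 3. An element g = (g_1, …, g_m) of G^m (acting componentwise, with g_h acting on the array X_h) fixes the invariant q_{1,…,1} = tr(X_1⋯X_m)·tr((X_1⋯X_m)^{-1}) if and only if g_1 = g_2 = ⋯ = g_m. -/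
noncomputable section

open scoped Classical

/-- The Laurent monomial `∏ h, x_{h, p h} / x_{h, q h}`. -/
def rowRatio (k : Type) [Field k] (m n : ℕ) (p q : Fin m → Fin n) : RFM k m n :=
  ∏ h, xm k m n h (p h) * (xm k m n h (q h))⁻¹

/-- The exponent vector of `rowRatio` multiplied by the product of all variables. -/
def rowExp (m n : ℕ) (p q : Fin m → Fin n) : (Fin m × Fin n) →₀ ℕ :=
  Finsupp.equivFunOnFinite.symm fun v ↦
    1 + (if v.2 = p v.1 then 1 else 0) - (if v.2 = q v.1 then 1 else 0)

theorem rowExp_apply (m n : ℕ) (p q : Fin m → Fin n) (h : Fin m) (a : Fin n) :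
    rowExp m n p q (h, a) =
      1 + (if a = p h then 1 else 0) - (if a = q h then 1 else 0) :=
  rfl

theorem prod_mul_rowRatio (k : Type) [Field k] (m n : ℕ) (p q : Fin m → Fin n) :
    (∏ h, ∏ a, xm k m n h a) * rowRatio k m n p q =
      algebraMap (MvPolynomial (Fin m × Fin n) k) (RFM k m n)
        (MvPolynomial.monomial (rowExp m n p q) 1) := by
  rw [MvPolynomial.monomial_eq, Finsupp.prod_fintype _ _ (fun _ ↦ pow_zero _), map_one, one_mul,
    map_prod, Fintype.prod_prod_type, rowRatio, ← Finset.prod_mul_distrib]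
  refine Finset.prod_congr rfl fun h _ ↦ ?_
  have single (c : Fin n) :
      xm k m n h c = ∏ a, xm k m n h a ^ (if a = c then 1 else 0) := by
    simp [pow_ite]
  rw [single (p h), single (q h), ← Finset.prod_inv_distrib, ← Finset.prod_mul_distrib,
    ← Finset.prod_mul_distrib]
  refine Finset.prod_congr rfl fun a _ ↦ ?_
  have hx := xm_ne_zero k m n h a
  rw [map_pow, rowExp_apply]
  change _ = xm k m n h a ^ _
  split_ifs <;> simp [hx, pow_two]

/-- Away from the diagonal, `rowExp` determines the pair of index functions. -/
theorem eq_of_rowExp_eq {m n : ℕ} {p q p' q' : Fin m → Fin n}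
    (hE : rowExp m n p q = rowExp m n p' q') {h : Fin m} (hpq : p h ≠ q h) :
    p h = p' h ∧ q h = q' h := by
  have h₁ := DFunLike.congr_fun hE (h, p h)
  have h₂ := DFunLike.congr_fun hE (h, q h)
  simp only [rowExp_apply, if_true, if_neg hpq, if_neg hpq.symm] at h₁ h₂
  constructor
  · by_contra hne
    simp only [if_neg hne] at h₁
    omega
  · by_contra hne
    simp only [if_neg hne] at h₂
    omega

/-- Equal sums of Laurent monomials have the same exponent vectors. -/
theorem exists_rowExp_eq {k : Type} [Field k] [CharZero k] {m n : ℕ} {ι : Type} [Fintype ι]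
    {p q p' q' : ι → Fin m → Fin n}
    (hsum : ∑ s, rowRatio k m n (p s) (q s) = ∑ s, rowRatio k m n (p' s) (q' s)) (s : ι) :
    ∃ t, rowExp m n (p s) (q s) = rowExp m n (p' t) (q' t) := by
  have hpoly := congrArg (fun r ↦ (∏ h, ∏ a, xm k m n h a) * r) hsum
  simp only [Finset.mul_sum, prod_mul_rowRatio, ← map_sum] at hpoly
  have hcoeff := congrArg (MvPolynomial.coeff (rowExp m n (p s) (q s)))
    (IsFractionRing.injective _ _ hpoly)
  simp only [MvPolynomial.coeff_sum, MvPolynomial.coeff_monomial, Finset.sum_boole] at hcoeff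
  have hcard := Nat.cast_injective hcoeff
  have hpos : 0 < (Finset.univ.filter
      fun t ↦ rowExp m n (p t) (q t) = rowExp m n (p s) (q s)).card :=
    Finset.card_pos.mpr ⟨s, by simp⟩
  rw [hcard] at hpos
  obtain ⟨t, ht⟩ := Finset.card_pos.mp hpos
  exact ⟨t, (Finset.mem_filter.mp ht).2.symm⟩

theorem q11_eq_sum_s15 (k : Type) [Field k] (m n : ℕ) :
    q11 k m n = ∑ s : Fin n × Fin n, rowRatio k m n (fun _ ↦ s.1) (fun _ ↦ s.2) := by
  simp only [q11, rowRatio, Finset.sum_mul_sum, Fintype.sum_prod_type, Finset.prod_mul_distrib]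

theorem map_q11_eq_sum {k : Type} [Field k] {m n : ℕ}
    {σ : Fin m → Equiv.Perm (Fin n)} {ε : Fin m → Bool} {φ : RFM k m n ≃ₐ[k] RFM k m n}
    (hφ : ∀ h j, φ (xm k m n h j) =
      if ε h then (xm k m n h (σ h j))⁻¹ else xm k m n h (σ h j)) :
    φ (q11 k m n) = ∑ s : Fin n × Fin n,
      rowRatio k m n (fun h ↦ σ h (if ε h then s.2 else s.1))
        (fun h ↦ σ h (if ε h then s.1 else s.2)) := by
  simp only [q11_eq_sum_s15, rowRatio, map_sum, map_prod, map_mul, map_inv₀, hφ]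
  refine Finset.sum_congr rfl fun s _ ↦ Finset.prod_congr rfl fun h _ ↦ ?_
  split_ifs
  · rw [inv_inv, mul_comm]
  · rfl

/-- For `n ≥ 3`, an element `g = (g_1, …, g_m)` of `G^m` (with
`g_h = (σ_h, ε_h) ∈ S_n × T` acting on the array `X_h`) fixes
`q_{1,…,1} = tr(X_1⋯X_m)·tr((X_1⋯X_m)⁻¹)` if and only if
`g_1 = g_2 = ⋯ = g_m`. -/
theorem stmt15 (k : Type) [Field k] [CharZero k] (m n : ℕ) (hn : 3 ≤ n)
    (σ : Fin m → Equiv.Perm (Fin n)) (ε : Fin m → Bool)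
    (φ : RFM k m n ≃ₐ[k] RFM k m n)
    (hφ : ∀ h j, φ (xm k m n h j) =
      if ε h then (xm k m n h (σ h j))⁻¹ else xm k m n h (σ h j)) :
    φ (q11 k m n) = q11 k m n ↔ ∀ h h' : Fin m, σ h = σ h' ∧ ε h = ε h' := by
  rw [map_q11_eq_sum hφ, q11_eq_sum_s15]
  constructor
  · intro hsum
    have key (i j : Fin n) (hij : i ≠ j) (h h' : Fin m) :
        σ h (if ε h then j else i) = σ h' (if ε h' then j else i) := by
      obtain ⟨t, ht⟩ := exists_rowExp_eq hsum (i, j)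
      have hne (l : Fin m) :
          σ l (if ε l then j else i) ≠ σ l (if ε l then i else j) := by
        rw [(σ l).injective.ne_iff]
        split_ifs
        exacts [hij.symm, hij]
      exact (eq_of_rowExp_eq ht (hne h)).1.trans (eq_of_rowExp_eq ht (hne h')).1.symm
    have : Nontrivial (Fin n) := Fin.nontrivial_iff_two_le.mpr (by omega)
    have hmixed (h h' : Fin m) (hh : ε h = true) (hh' : ε h' = false) : False := by
      have h₁ := key ⟨0, by omega⟩ ⟨1, by omega⟩ (by simp) h h'
      have h₂ := key ⟨0, by omega⟩ ⟨2, by omega⟩ (by simp) h h'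
      simp only [hh, hh', if_true, Bool.false_eq_true, if_false] at h₁ h₂
      simpa using (σ h).injective (h₁.trans h₂.symm)
    intro h h'
    have hε : ε h = ε h' := by
      cases hh : ε h <;> cases hh' : ε h'
      · rfl
      · exact (hmixed h' h hh' hh).elim
      · exact (hmixed h h' hh hh').elim
      · rfl
    refine ⟨Equiv.ext fun i ↦ ?_, hε⟩
    obtain ⟨j, hj⟩ := exists_ne i
    cases hh : ε h'
    · simpa [hε, hh] using key i j hj.symm h h'
    · simpa [hε, hh] using key j i hj h h'
  · intro hall
    rcases isEmpty_or_nonempty (Fin m) with hm | ⟨⟨h₀⟩⟩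
    · simp [rowRatio]
    · simp only [fun h ↦ (hall h h₀).1, fun h ↦ (hall h h₀).2]
      cases ε h₀
      · exact ((σ h₀).prodCongr (σ h₀)).sum_comp
          fun s ↦ rowRatio k m n (fun _ ↦ s.1) (fun _ ↦ s.2)
      · exact ((Equiv.prodComm _ _).trans ((σ h₀).prodCongr (σ h₀))).sum_comp
          fun s ↦ rowRatio k m n (fun _ ↦ s.1) (fun _ ↦ s.2)
end
end
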